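/- Let 0 < ε < 1/4 and let f encode a smooth embedded paper Moebius band of aspect ratio λ with λ < √3 + ε. Then there exist points A, B, C ∈ ℝ³ with pairwise distances 2√3/3, a continuous 2√3-periodic curve γ₀ : ℝ → ℝ³ that traverses the boundary of the triangle with vertices A, B, C once at unit speed (γ₀ maps [0, 2√3] onto segment[A,B] ∪ segment[B,C] ∪ segment[C,A], is affine with speed 1 on each of the three parameter intervals corresponding to the edges, and satisfies γ₀(s + 2√3) = γ₀(s)), a continuous strictly increasing map φ : ℝ → ℝ with φ(s + 2√3) = φ(s) + 2λ for all s, and an isometry ψ : ℝ³ → ℝ³, such that ‖γ₀(s) − ψ(f (φ s) 0)‖ < 6√ε for all s ∈ ℝ. -/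

import Mathlib

open scoped ContDiff

namespace PaperMoebius

section DirectionalDerivative

variable {V : Type*} [NormedAddCommGroup V] [NormedSpace ℝ V]

/-- The derivative of `G` in the constant direction `v`. -/
noncomputable def dirDeriv (v : ℝ × ℝ) (G : ℝ × ℝ → V) : ℝ × ℝ → V :=
  fun p => fderiv ℝ G p v

theorem contDiff_dirDeriv {G : ℝ × ℝ → V} (hG : ContDiff ℝ ∞ G) (v : ℝ × ℝ) :
    ContDiff ℝ ∞ (dirDeriv v G) :=
  (hG.fderiv_right (m := ∞) (by simp)).clm_apply contDiff_const

theorem dirDeriv_dirDeriv_apply {G : ℝ × ℝ → V} (hG : ContDiff ℝ ∞ G) (v w p : ℝ × ℝ) :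
    dirDeriv v (dirDeriv w G) p = fderiv ℝ (fderiv ℝ G) p v w := by
  have h : DifferentiableAt ℝ (fderiv ℝ G) p :=
    ((hG.fderiv_right (m := ∞) (by simp)).differentiable (by simp)) p
  unfold dirDeriv
  rw [fderiv_clm_apply h (differentiableAt_const w)]
  simp

theorem dirDeriv_comm {G : ℝ × ℝ → V} (hG : ContDiff ℝ ∞ G) (v w : ℝ × ℝ) :
    dirDeriv v (dirDeriv w G) = dirDeriv w (dirDeriv v G) := by
  funext p
  rw [dirDeriv_dirDeriv_apply hG, dirDeriv_dirDeriv_apply hG]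
  exact (hG.contDiffAt (x := p)).isSymmSndFDerivAt (by simpa using ENat.LEInfty.out) v w

theorem hasDerivAt_line {G : ℝ × ℝ → V} (hG : ContDiff ℝ ∞ G) (p v : ℝ × ℝ) (s : ℝ) :
    HasDerivAt (fun s : ℝ => G (p + s • v)) (dirDeriv v G (p + s • v)) s := by
  have h1 : HasDerivAt (fun s : ℝ => p + s • v) v s := by
    simpa using ((hasDerivAt_id s).smul_const v).const_add p
  exact ((hG.differentiable (by simp)) (p + s • v)).hasFDerivAt.comp_hasDerivAt s h1

theorem dirDeriv_congr {G H : ℝ × ℝ → V} {Ω : Set (ℝ × ℝ)} (hΩ : IsOpen Ω)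
    (h : ∀ p ∈ Ω, G p = H p) (v : ℝ × ℝ) {p : ℝ × ℝ} (hp : p ∈ Ω) :
    dirDeriv v G p = dirDeriv v H p := by
  have : G =ᶠ[nhds p] H := Filter.eventually_of_mem (hΩ.mem_nhds hp) h
  simp only [dirDeriv, this.fderiv_eq]

theorem dirDeriv_mul {g h : ℝ × ℝ → ℝ} (hg : ContDiff ℝ ∞ g) (hh : ContDiff ℝ ∞ h)
    (v p : ℝ × ℝ) :
    dirDeriv v (fun q => g q * h q) p = dirDeriv v g p * h p + g p * dirDeriv v h p := by
  unfold dirDeriv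
  rw [fderiv_fun_mul (hg.differentiable (by simp) p) (hh.differentiable (by simp) p)]
  simp
  ring

theorem dirDeriv_const (v : ℝ × ℝ) (c : V) (p : ℝ × ℝ) : dirDeriv v (fun _ => c) p = 0 := by
  simp [dirDeriv]

theorem dirDeriv_add {g h : ℝ × ℝ → V} (hg : ContDiff ℝ ∞ g) (hh : ContDiff ℝ ∞ h)
    (v p : ℝ × ℝ) :
    dirDeriv v (fun q => g q + h q) p = dirDeriv v g p + dirDeriv v h p := by
  unfold dirDeriv
  rw [fderiv_fun_add (hg.differentiable (by simp) p) (hh.differentiable (by simp) p)]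
  simp

theorem dirDeriv_inner {W : Type*} [NormedAddCommGroup W] [InnerProductSpace ℝ W]
    {g h : ℝ × ℝ → W} (hg : ContDiff ℝ ∞ g) (hh : ContDiff ℝ ∞ h) (v p : ℝ × ℝ) :
    dirDeriv v (fun q => inner ℝ (g q) (h q)) p =
      inner ℝ (g p) (dirDeriv v h p) + inner ℝ (dirDeriv v g p) (h p) := by
  unfold dirDeriv
  rw [fderiv_inner_apply ℝ (hg.differentiable (by simp) p) (hh.differentiable (by simp) p)]

end DirectionalDerivative

/-- If the Hessian determinant of `u` vanishes on an open set, then a null direction of a nonzero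
Hessian stays null along the straight line it spans, and the Hessian does not vanish there. -/
theorem hessian_kernel_along_line {u : ℝ × ℝ → ℝ} (hu : ContDiff ℝ ∞ u) {Ω : Set (ℝ × ℝ)}
    (hΩ : IsOpen Ω) (v w : ℝ × ℝ)
    (hdet : ∀ p ∈ Ω, dirDeriv v (dirDeriv v u) p * dirDeriv w (dirDeriv w u) p
      = dirDeriv v (dirDeriv w u) p ^ 2)
    (p : ℝ × ℝ) {S : ℝ} (hS : ∀ s ∈ Set.Icc 0 S, p + s • v ∈ Ω)
    (hb : dirDeriv v (dirDeriv w u) p = 0) (hc : dirDeriv w (dirDeriv w u) p ≠ 0)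
    (s : ℝ) (hs : s ∈ Set.Icc 0 S) :
    dirDeriv w (dirDeriv w u) (p + s • v) ≠ 0 ∧ dirDeriv v (dirDeriv w u) (p + s • v) = 0 ∧
      dirDeriv v (dirDeriv v u) (p + s • v) = 0 := by
  set a := dirDeriv v (dirDeriv v u) with ha_def
  set b := dirDeriv v (dirDeriv w u) with hb_def
  set c := dirDeriv w (dirDeriv w u) with hc_def
  have ha : ContDiff ℝ ∞ a := contDiff_dirDeriv (contDiff_dirDeriv hu _) _
  have hb' : ContDiff ℝ ∞ b := contDiff_dirDeriv (contDiff_dirDeriv hu _) _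
  have hc' : ContDiff ℝ ∞ c := contDiff_dirDeriv (contDiff_dirDeriv hu _) _
  have haw : dirDeriv w a = dirDeriv v b := by
    rw [ha_def, hb_def, dirDeriv_comm (contDiff_dirDeriv hu v), dirDeriv_comm hu]
  have hbw : dirDeriv w b = dirDeriv v c := by
    rw [hb_def, hc_def, dirDeriv_comm (contDiff_dirDeriv hu w)]
  -- the determinant identity differentiated once, and then twice, in the direction `w`
  have e1 : ∀ q ∈ Ω, dirDeriv v b q * c q + a q * dirDeriv w c q
      = 2 * (b q * dirDeriv v c q) := by
    intro q hq
    have := dirDeriv_congr hΩ (G := fun q => a q * c q) (H := fun q => b q * b q)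
      (fun q hq => by rw [hdet q hq, sq]) w hq
    rw [dirDeriv_mul ha hc', dirDeriv_mul hb' hb', haw, hbw] at this
    linarith
  have e2 : ∀ q ∈ Ω, (dirDeriv v (dirDeriv v c) q * c q + dirDeriv v b q * dirDeriv w c q)
      + (dirDeriv v b q * dirDeriv w c q + a q * dirDeriv w (dirDeriv w c) q)
      = 2 * (dirDeriv v c q * dirDeriv v c q + b q * dirDeriv w (dirDeriv v c) q) := by
    intro q hq
    have hvb := contDiff_dirDeriv hb' v
    have hwc := contDiff_dirDeriv hc' w
    have hvc := contDiff_dirDeriv hc' v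
    have := dirDeriv_congr hΩ
      (G := fun q => dirDeriv v b q * c q + a q * dirDeriv w c q)
      (H := fun q => 2 * (b q * dirDeriv v c q)) e1 w hq
    rw [dirDeriv_add (hvb.mul hc') (ha.mul hwc), dirDeriv_mul hvb hc', dirDeriv_mul ha hwc,
      dirDeriv_mul contDiff_const (hb'.mul hvc), dirDeriv_mul hb' hvc, dirDeriv_const,
      haw, hbw, dirDeriv_comm hb', hbw] at this
    linarith
  have cont : ∀ {g : ℝ × ℝ → ℝ}, ContDiff ℝ ∞ g → Continuous (fun s : ℝ => g (p + s • v)) :=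
    fun hg => hg.continuous.comp (by fun_prop)
  -- as long as `c ≠ 0`, linear ODE uniqueness gives `b = 0`
  have stepA : ∀ S' ≤ S, (∀ s ∈ Set.Icc 0 S', c (p + s • v) ≠ 0) →
      ∀ s ∈ Set.Icc 0 S', b (p + s • v) = 0 ∧ a (p + s • v) = 0 := by
    intro S' hS' hne
    set g : ℝ → ℝ := fun s => (2 * dirDeriv v c (p + s • v)
      - b (p + s • v) * dirDeriv w c (p + s • v) / c (p + s • v)) / c (p + s • v) with hg
    have hgc : ContinuousOn g (Set.Icc 0 S') := by
      have h1 := (cont (contDiff_dirDeriv hc' v)).continuousOn (s := Set.Icc 0 S')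
      have h2 := (cont (contDiff_dirDeriv hc' w)).continuousOn (s := Set.Icc 0 S')
      have h3 := (cont hb').continuousOn (s := Set.Icc 0 S')
      have h4 := (cont hc').continuousOn (s := Set.Icc 0 S')
      exact ((continuousOn_const.mul h1).sub ((h3.mul h2).div h4 hne)).div h4 hne
    obtain ⟨K, hK⟩ := isCompact_Icc.exists_bound_of_continuousOn hgc
    have key := eq_zero_of_abs_deriv_le_mul_abs_self_of_eq_zero_right
      (f := fun s => b (p + s • v)) (f' := fun s => dirDeriv v b (p + s • v)) (K := K)
      (a := 0) (b := S') (cont hb').continuousOn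
      (fun x _ => (hasDerivAt_line hb' p v x).hasDerivWithinAt) (by simpa using hb)
      (by
        intro x hx
        have hx' : x ∈ Set.Icc 0 S' := ⟨hx.1, hx.2.le⟩
        have hq := hS x ⟨hx.1, hx.2.le.trans hS'⟩
        have hcx := hne x hx'
        have : dirDeriv v b (p + x • v) = g x * b (p + x • v) := by
          have h1 := e1 _ hq
          have h2 := hdet _ hq
          have h3 : a (p + x • v) = b (p + x • v) ^ 2 / c (p + x • v) := by
            field_simp; linarith
          rw [h3] at h1
          have h4 : dirDeriv v b (p + x • v) = (2 * (b (p + x • v) * dirDeriv v c (p + x • v))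
            - b (p + x • v) ^ 2 / c (p + x • v) * dirDeriv w c (p + x • v)) / c (p + x • v) := by
            rw [eq_div_iff hcx]; linarith
          rw [h4, hg]
          field_simp
        simp only [this, norm_mul]
        exact mul_le_mul_of_nonneg_right (hK x hx') (norm_nonneg _))
    intro s hs
    have hbs : b (p + s • v) = 0 := key s hs
    refine ⟨hbs, ?_⟩
    have h2 := hdet _ (hS s ⟨hs.1, hs.2.trans hS'⟩)
    rw [hbs] at h2
    have h3 := hne s hs
    simpa [h3] using h2
  have hcne : ∀ s ∈ Set.Icc 0 S, c (p + s • v) ≠ 0 := by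
    by_contra! hcon
    obtain ⟨s1, hs1, hcs1⟩ := hcon
    set Z : Set ℝ := {s | s ∈ Set.Icc 0 S ∧ c (p + s • v) = 0} with hZ
    have hZc : IsClosed Z := isClosed_Icc.inter (isClosed_eq (cont hc') continuous_const)
    have hZn : Z.Nonempty := ⟨s1, hs1, hcs1⟩
    have hZb : BddBelow Z := ⟨0, fun s hs => hs.1.1⟩
    obtain ⟨hs0S, hcs0⟩ : sInf Z ∈ Z := hZc.csInf_mem hZn hZb
    set s0 := sInf Z with hs0
    have hpos : 0 < s0 := by
      rcases hs0S.1.lt_or_eq with h | h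
      · exact h
      · rw [← h] at hcs0; simp at hcs0; exact absurd hcs0 hc
    have hne : ∀ s, 0 ≤ s → s < s0 → c (p + s • v) ≠ 0 := by
      intro s h0 hlt h
      exact absurd (csInf_le hZb (show s ∈ Z from ⟨⟨h0, hlt.le.trans hs0S.2⟩, h⟩)) (not_le.mpr hlt)
    set K := dirDeriv v c p / c p ^ 2 with hKdef
    have hinv : ∀ s ∈ Set.Ico 0 s0, c (p + s • v) * ((c p)⁻¹ - K * s) = 1 := by
      intro s hs
      have hne' : ∀ x ∈ Set.Icc 0 s, c (p + x • v) ≠ 0 :=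
        fun x hx => hne x hx.1 (hx.2.trans_lt hs.2)
      have hA := stepA s (hs.2.le.trans hs0S.2) hne'
      have hvc := contDiff_dirDeriv hc' v
      have hbx : ∀ x ∈ Set.Ico 0 s, dirDeriv v b (p + x • v) = 0 := by
        intro x hx
        have hx' : x ∈ Set.Icc 0 s := ⟨hx.1, hx.2.le⟩
        have h1 := e1 _ (hS x ⟨hx.1, (hx.2.trans hs.2).le.trans hs0S.2⟩)
        rw [(hA x hx').1, (hA x hx').2] at h1
        simpa [hne' x hx'] using h1
      have hquot : ∀ x ∈ Set.Icc 0 s, dirDeriv v c (p + x • v) / c (p + x • v) ^ 2 = K := by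
        intro x hx
        have := constant_of_has_deriv_right_zero
          (f := fun x : ℝ => dirDeriv v c (p + x • v) / c (p + x • v) ^ 2) (a := 0) (b := s)
          ((cont hvc).continuousOn.div ((cont hc').continuousOn.pow 2)
            (fun x hx => pow_ne_zero 2 (hne' x hx)))
          (by
            intro x hx
            have hx' : x ∈ Set.Icc 0 s := ⟨hx.1, hx.2.le⟩
            have hd := ((hasDerivAt_line hvc p v x).div ((hasDerivAt_line hc' p v x).pow 2)
              (pow_ne_zero 2 (hne' x hx')))
            have h2 := e2 _ (hS x ⟨hx.1, (hx.2.trans hs.2).le.trans hs0S.2⟩)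
            rw [(hA x hx').1, (hA x hx').2, hbx x hx] at h2
            refine (hd.congr_deriv ?_).hasDerivWithinAt
            have hcx := hne' x hx'
            rw [div_eq_zero_iff]
            left
            simp only [Pi.pow_apply]
            linear_combination (c (p + x • v)) * h2) x hx
        simpa using this
      have := constant_of_has_deriv_right_zero
          (f := fun x : ℝ => (c (p + x • v))⁻¹ + K * x) (a := 0) (b := s)
          (((cont hc').continuousOn.inv₀ hne').add (by fun_prop))
          (by
            intro x hx
            have hx' : x ∈ Set.Icc 0 s := ⟨hx.1, hx.2.le⟩
            have hd := ((hasDerivAt_line hc' p v x).inv (hne' x hx')).add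
              ((hasDerivAt_id x).const_mul K)
            refine (hd.congr_deriv ?_).hasDerivWithinAt
            rw [← hquot x hx']
            ring) s ⟨hs.1, le_rfl⟩
      simp only [zero_smul, add_zero, mul_zero] at this
      have h5 := hne' s ⟨hs.1, le_rfl⟩
      rw [← this]
      field_simp
      ring
    have hcl : Set.EqOn (fun s : ℝ => c (p + s • v) * ((c p)⁻¹ - K * s)) (fun _ => 1)
        (closure (Set.Ico 0 s0)) :=
      Set.EqOn.closure hinv ((cont hc').mul (by fun_prop)) continuous_const
    have h1 : s0 ∈ closure (Set.Ico 0 s0) := by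
      rw [closure_Ico hpos.ne]; exact ⟨hpos.le, le_rfl⟩
    have := hcl h1
    simp [hcs0] at this
  exact ⟨hcne s hs, stepA S le_rfl hcne s hs⟩

/-- Three-dimensional Euclidean space. -/
abbrev E3 := EuclideanSpace ℝ (Fin 3)

theorem inner_eq_coords (u v : E3) : inner ℝ u v = u 0 * v 0 + u 1 * v 1 + u 2 * v 2 := by
  simp [PiLp.inner_apply, Fin.sum_univ_three]
  ring

theorem eq_zero_of_sum_three_sq {x y z : ℝ} (h : x ^ 2 + y ^ 2 + z ^ 2 = 0) :
    x = 0 ∧ y = 0 ∧ z = 0 := by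
  refine ⟨?_, ?_, ?_⟩ <;> nlinarith [sq_nonneg x, sq_nonneg y, sq_nonneg z]

/-- Vectors orthogonal to two given orthonormal vectors of `ℝ³` are multiples of one vector. -/
theorem exists_normal {X Y : E3} (hX : inner ℝ X X = (1 : ℝ)) (hY : inner ℝ Y Y = (1 : ℝ))
    (hXY : inner ℝ X Y = (0 : ℝ)) :
    ∃ n : E3, ∀ z : E3, inner ℝ z X = (0 : ℝ) → inner ℝ z Y = (0 : ℝ) → ∃ c : ℝ, z = c • n := by
  set n : E3 := !₂[X 1 * Y 2 - X 2 * Y 1, X 2 * Y 0 - X 0 * Y 2, X 0 * Y 1 - X 1 * Y 0] with hn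
  refine ⟨n, fun z hzX hzY => ⟨inner ℝ z n, ?_⟩⟩
  simp only [inner_eq_coords] at *
  have h0 : n 0 = X 1 * Y 2 - X 2 * Y 1 := rfl
  have h1 : n 1 = X 2 * Y 0 - X 0 * Y 2 := rfl
  have h2 : n 2 = X 0 * Y 1 - X 1 * Y 0 := rfl
  have key : (z 0 - (z 0 * n 0 + z 1 * n 1 + z 2 * n 2) * n 0) ^ 2
      + (z 1 - (z 0 * n 0 + z 1 * n 1 + z 2 * n 2) * n 1) ^ 2
      + (z 2 - (z 0 * n 0 + z 1 * n 1 + z 2 * n 2) * n 2) ^ 2 = 0 := by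
    have hnn : n 0 ^ 2 + n 1 ^ 2 + n 2 ^ 2 = 1 := by
      rw [h0, h1, h2]
      linear_combination (Y 0 * Y 0 + Y 1 * Y 1 + Y 2 * Y 2) * hX + hY
        - (X 0 * Y 0 + X 1 * Y 1 + X 2 * Y 2) * hXY
    have hgram : (z 0 * n 0 + z 1 * n 1 + z 2 * n 2) ^ 2 = z 0 ^ 2 + z 1 ^ 2 + z 2 ^ 2 := by
      have : (z 0 * n 0 + z 1 * n 1 + z 2 * n 2) ^ 2
        = (z 0 ^ 2 + z 1 ^ 2 + z 2 ^ 2) * ((X 0 * X 0 + X 1 * X 1 + X 2 * X 2)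
            * (Y 0 * Y 0 + Y 1 * Y 1 + Y 2 * Y 2) - (X 0 * Y 0 + X 1 * Y 1 + X 2 * Y 2) ^ 2)
          - (z 0 * X 0 + z 1 * X 1 + z 2 * X 2) ^ 2 * (Y 0 * Y 0 + Y 1 * Y 1 + Y 2 * Y 2)
          - (z 0 * Y 0 + z 1 * Y 1 + z 2 * Y 2) ^ 2 * (X 0 * X 0 + X 1 * X 1 + X 2 * X 2)
          + 2 * (z 0 * X 0 + z 1 * X 1 + z 2 * X 2) * (z 0 * Y 0 + z 1 * Y 1 + z 2 * Y 2)
            * (X 0 * Y 0 + X 1 * Y 1 + X 2 * Y 2) := by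
        rw [h0, h1, h2]; ring
      rw [this, hX, hY, hXY, hzX, hzY]; ring
    linear_combination (z 0 * n 0 + z 1 * n 1 + z 2 * n 2) ^ 2 * hnn - hgram
  obtain ⟨k0, k1, k2⟩ := eq_zero_of_sum_three_sq key
  ext i
  fin_cases i
  · simpa using sub_eq_zero.1 k0
  · simpa using sub_eq_zero.1 k1
  · simpa using sub_eq_zero.1 k2

/-- A paper Moebius band of aspect ratio `lam`, not assumed embedded. -/
structure IsPaperBand (lam : ℝ) (f : ℝ → ℝ → E3) : Prop where
  pos : 0 < lam
  smooth : ContDiff ℝ ∞ (fun p : ℝ × ℝ => f p.1 p.2)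
  glue : ∀ x : ℝ, ∀ y ∈ Set.Icc (0 : ℝ) 1, f (x + lam) (1 - y) = f x y
  isom : ∀ p : ℝ × ℝ, p.2 ∈ Set.Icc (0 : ℝ) 1 → ∀ v : ℝ × ℝ,
    ‖fderiv ℝ (fun q : ℝ × ℝ => f q.1 q.2) p v‖ = Real.sqrt (v.1 ^ 2 + v.2 ^ 2)

/-- The open strip covering the band. -/
def openStrip : Set (ℝ × ℝ) := {p | p.2 ∈ Set.Ioo (0 : ℝ) 1}

theorem isOpen_openStrip : IsOpen openStrip := isOpen_Ioo.preimage continuous_snd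

theorem openStrip_le {p : ℝ × ℝ} (hp : p ∈ openStrip) : p.2 ∈ Set.Icc (0 : ℝ) 1 :=
  ⟨hp.1.le, hp.2.le⟩

/-- The map of the plane underlying a curried map. -/
def unc (f : ℝ → ℝ → E3) : ℝ × ℝ → E3 := fun p => f p.1 p.2

namespace IsPaperBand

variable {lam : ℝ} {f : ℝ → ℝ → E3}

theorem contDiff (h : IsPaperBand lam f) : ContDiff ℝ ∞ (unc f) := h.smooth

theorem norm_dirDeriv (h : IsPaperBand lam f) {p : ℝ × ℝ} (hp : p.2 ∈ Set.Icc (0 : ℝ) 1)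
    (v : ℝ × ℝ) : ‖dirDeriv v (unc f) p‖ = Real.sqrt (v.1 ^ 2 + v.2 ^ 2) := h.isom p hp v

theorem inner_dirDeriv (h : IsPaperBand lam f) {p : ℝ × ℝ} (hp : p.2 ∈ Set.Icc (0 : ℝ) 1)
    (v w : ℝ × ℝ) :
    inner ℝ (dirDeriv v (unc f) p) (dirDeriv w (unc f) p) = v.1 * w.1 + v.2 * w.2 := by
  have hsq : ∀ v : ℝ × ℝ, ‖dirDeriv v (unc f) p‖ * ‖dirDeriv v (unc f) p‖ = v.1 ^ 2 + v.2 ^ 2 := by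
    intro v
    rw [h.norm_dirDeriv hp, Real.mul_self_sqrt (by positivity)]
  rw [real_inner_eq_norm_add_mul_self_sub_norm_mul_self_sub_norm_mul_self_div_two]
  have : dirDeriv v (unc f) p + dirDeriv w (unc f) p = dirDeriv (v + w) (unc f) p := by
    simp [dirDeriv]
  rw [this, hsq, hsq, hsq]
  simp
  ring

theorem inner_second_first (h : IsPaperBand lam f) {p : ℝ × ℝ} (hp : p ∈ openStrip)
    (z v w : ℝ × ℝ) :
    inner ℝ (dirDeriv z (dirDeriv v (unc f)) p) (dirDeriv w (unc f) p) = (0 : ℝ) := by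
  have hF := h.contDiff
  have anti : ∀ z v w : ℝ × ℝ,
      inner ℝ (dirDeriv z (dirDeriv v (unc f)) p) (dirDeriv w (unc f) p)
        = -inner ℝ (dirDeriv z (dirDeriv w (unc f)) p) (dirDeriv v (unc f) p) := by
    intro z v w
    have := dirDeriv_congr isOpen_openStrip
      (G := fun q => inner ℝ (dirDeriv v (unc f) q) (dirDeriv w (unc f) q))
      (H := fun _ => v.1 * w.1 + v.2 * w.2)
      (fun q hq => h.inner_dirDeriv (openStrip_le hq) v w) z hp
    rw [dirDeriv_inner (contDiff_dirDeriv hF v) (contDiff_dirDeriv hF w), dirDeriv_const,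
      real_inner_comm] at this
    linarith
  have sym : ∀ z v w : ℝ × ℝ,
      inner ℝ (dirDeriv z (dirDeriv v (unc f)) p) (dirDeriv w (unc f) p)
        = (inner ℝ (dirDeriv v (dirDeriv z (unc f)) p) (dirDeriv w (unc f) p) : ℝ) := by
    intro z v w
    rw [dirDeriv_comm hF]
  linarith [anti z v w, sym z w v, anti w z v, sym w v z, anti v w z, sym v z w]

theorem inner_second_second (h : IsPaperBand lam f) {p : ℝ × ℝ} (hp : p ∈ openStrip)
    (v w : ℝ × ℝ) :
    inner ℝ (dirDeriv v (dirDeriv v (unc f)) p) (dirDeriv w (dirDeriv w (unc f)) p)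
      = (inner ℝ (dirDeriv v (dirDeriv w (unc f)) p) (dirDeriv v (dirDeriv w (unc f)) p) : ℝ) := by
  have hF := h.contDiff
  have key : ∀ y z v w : ℝ × ℝ,
      inner ℝ (dirDeriv z (dirDeriv v (unc f)) p) (dirDeriv y (dirDeriv w (unc f)) p)
        = -inner ℝ (dirDeriv y (dirDeriv z (dirDeriv v (unc f))) p) (dirDeriv w (unc f) p) := by
    intro y z v w
    have := dirDeriv_congr isOpen_openStrip
      (G := fun q => inner ℝ (dirDeriv z (dirDeriv v (unc f)) q) (dirDeriv w (unc f) q))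
      (H := fun _ => (0 : ℝ))
      (fun q hq => h.inner_second_first hq z v w) y hp
    rw [dirDeriv_inner (contDiff_dirDeriv (contDiff_dirDeriv hF v) z) (contDiff_dirDeriv hF w),
      dirDeriv_const] at this
    linarith
  have k1 := key w v v w
  have k2 := key v v w w
  rw [dirDeriv_comm (contDiff_dirDeriv hF v), dirDeriv_comm hF w v] at k1
  rw [k1, ← k2]

theorem exists_normal_second (h : IsPaperBand lam f) {p : ℝ × ℝ} (hp : p ∈ openStrip) :
    ∃ n : E3, ∀ v w : ℝ × ℝ, ∃ c : ℝ, dirDeriv v (dirDeriv w (unc f)) p = c • n := by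
  have hp' := openStrip_le hp
  obtain ⟨n, hn⟩ := exists_normal (X := dirDeriv (1, 0) (unc f) p) (Y := dirDeriv (0, 1) (unc f) p)
    (by rw [h.inner_dirDeriv hp']; norm_num) (by rw [h.inner_dirDeriv hp']; norm_num)
    (by rw [h.inner_dirDeriv hp']; norm_num)
  exact ⟨n, fun v w => hn _ (h.inner_second_first hp v w _) (h.inner_second_first hp v w _)⟩

theorem component_hessian_det (h : IsPaperBand lam f) {p : ℝ × ℝ} (hp : p ∈ openStrip)
    (m : E3) (v w : ℝ × ℝ) :
    inner ℝ m (dirDeriv v (dirDeriv v (unc f)) p) * inner ℝ m (dirDeriv w (dirDeriv w (unc f)) p)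
      = (inner ℝ m (dirDeriv v (dirDeriv w (unc f)) p) : ℝ) ^ 2 := by
  obtain ⟨n, hn⟩ := h.exists_normal_second hp
  obtain ⟨c1, h1⟩ := hn v v
  obtain ⟨c2, h2⟩ := hn v w
  obtain ⟨c3, h3⟩ := hn w w
  have hg := h.inner_second_second hp v w
  rw [h1, h2, h3] at hg ⊢
  simp only [real_inner_smul_left, real_inner_smul_right] at hg ⊢
  rcases eq_or_ne n 0 with rfl | hne
  · simp
  · have hnn : (inner ℝ n n : ℝ) ≠ 0 := by simpa using hne
    have : c1 * c3 = c2 ^ 2 := by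
      apply mul_right_cancel₀ hnn
      linarith
    linear_combination (inner ℝ m n) ^ 2 * this

/-- The second derivative of `f` vanishes at `p`. -/
def Flat (f : ℝ → ℝ → E3) (p : ℝ × ℝ) : Prop :=
  ∀ v w : ℝ × ℝ, dirDeriv v (dirDeriv w (unc f)) p = 0

theorem dirDeriv2_comb (h : IsPaperBand lam f) (p : ℝ × ℝ) (a b a' b' : ℝ) (v w v' w' : ℝ × ℝ) :
    dirDeriv (a • v + b • w) (dirDeriv (a' • v' + b' • w') (unc f)) p
      = (a * a') • dirDeriv v (dirDeriv v' (unc f)) p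
        + (a * b') • dirDeriv v (dirDeriv w' (unc f)) p
        + (b * a') • dirDeriv w (dirDeriv v' (unc f)) p
        + (b * b') • dirDeriv w (dirDeriv w' (unc f)) p := by
  simp only [dirDeriv_dirDeriv_apply h.contDiff]
  simp only [map_add, map_smul, add_apply, smul_apply,
    smul_add, smul_smul]
  module

theorem decompose_basis {v w : ℝ × ℝ} (hvw : v.1 * w.2 - v.2 * w.1 ≠ 0) (z : ℝ × ℝ) :
    ∃ a b : ℝ, z = a • v + b • w := by
  refine ⟨(z.1 * w.2 - z.2 * w.1) / (v.1 * w.2 - v.2 * w.1),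
    (v.1 * z.2 - v.2 * z.1) / (v.1 * w.2 - v.2 * w.1), ?_⟩
  ext
  · simp only [Prod.fst_add, Prod.smul_fst, smul_eq_mul]
    rw [div_mul_eq_mul_div, div_mul_eq_mul_div, ← add_div, eq_div_iff hvw]
    ring
  · simp only [Prod.snd_add, Prod.smul_snd, smul_eq_mul]
    rw [div_mul_eq_mul_div, div_mul_eq_mul_div, ← add_div, eq_div_iff hvw]
    ring

theorem flat_of_basis (h : IsPaperBand lam f) {p v w : ℝ × ℝ}
    (hvw : v.1 * w.2 - v.2 * w.1 ≠ 0)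
    (h1 : dirDeriv v (dirDeriv v (unc f)) p = 0) (h2 : dirDeriv v (dirDeriv w (unc f)) p = 0)
    (h3 : dirDeriv w (dirDeriv w (unc f)) p = 0) : Flat f p := by
  intro z z'
  obtain ⟨a, b, rfl⟩ := decompose_basis hvw z
  obtain ⟨a', b', rfl⟩ := decompose_basis hvw z'
  rw [h.dirDeriv2_comb, dirDeriv_comm h.contDiff w v, h1, h2, h3]
  simp

/-- Two transversal directions in which the second derivative vanishes force flatness. -/
theorem flat_of_two_straight (h : IsPaperBand lam f) {p v w : ℝ × ℝ} (hp : p ∈ openStrip)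
    (hvw : v.1 * w.2 - v.2 * w.1 ≠ 0)
    (h1 : dirDeriv v (dirDeriv v (unc f)) p = 0)
    (h3 : dirDeriv w (dirDeriv w (unc f)) p = 0) : Flat f p := by
  refine h.flat_of_basis hvw h1 ?_ h3
  have := h.inner_second_second hp v w
  rw [h1, inner_zero_left] at this
  exact inner_self_eq_zero.1 this.symm

theorem exists_kernel (h : IsPaperBand lam f) {p : ℝ × ℝ} (hp : p ∈ openStrip)
    (hflat : ¬ Flat f p) :
    ∃ v : ℝ × ℝ, v ≠ 0 ∧ ∀ w, dirDeriv v (dirDeriv w (unc f)) p = 0 := by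
  obtain ⟨n, hn⟩ := h.exists_normal_second hp
  obtain ⟨c1, h1⟩ := hn (1, 0) (1, 0)
  obtain ⟨c2, h2⟩ := hn (1, 0) (0, 1)
  obtain ⟨c3, h3⟩ := hn (0, 1) (0, 1)
  have hbasis : ((1 : ℝ), (0 : ℝ)).1 * ((0 : ℝ), (1 : ℝ)).2
      - ((1 : ℝ), (0 : ℝ)).2 * ((0 : ℝ), (1 : ℝ)).1 ≠ 0 := by norm_num
  have hne : n ≠ 0 := by
    rintro rfl
    exact hflat (h.flat_of_basis hbasis (by simpa using h1) (by simpa using h2) (by simpa using h3))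
  have hdet : c1 * c3 = c2 ^ 2 := by
    have hg := h.inner_second_second hp (1, 0) (0, 1)
    rw [h1, h2, h3] at hg
    simp only [real_inner_smul_left, real_inner_smul_right] at hg
    have hnn : (inner ℝ n n : ℝ) ≠ 0 := by simpa using hne
    apply mul_right_cancel₀ hnn
    linarith
  have hD : ∀ (α β : ℝ) (w : ℝ × ℝ), dirDeriv (α, β) (dirDeriv w (unc f)) p
      = ((α * c1 + β * c2) * w.1 + (α * c2 + β * c3) * w.2) • n := by
    intro α β w
    have e1 : (α, β) = α • ((1 : ℝ), (0 : ℝ)) + β • ((0 : ℝ), (1 : ℝ)) := by simp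
    have e2 : w = w.1 • ((1 : ℝ), (0 : ℝ)) + w.2 • ((0 : ℝ), (1 : ℝ)) := by simp
    rw [e1, e2, h.dirDeriv2_comb, dirDeriv_comm h.contDiff (0, 1) (1, 0), h1, h2, h3]
    simp
    module
  by_cases h12 : c1 = 0 ∧ c2 = 0
  · refine ⟨(c3, -c2), ?_, fun w => ?_⟩
    · intro h0
      have hc3 : c3 = 0 := congrArg Prod.fst h0
      exact hflat (h.flat_of_basis hbasis (by simp [h1, h12.1]) (by simp [h2, h12.2])
        (by simp [h3, hc3]))
    · rw [hD, show (c3 * c1 + -c2 * c2) * w.1 + (c3 * c2 + -c2 * c3) * w.2 = 0 by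
        linear_combination w.1 * hdet, zero_smul]
  · refine ⟨(c2, -c1), ?_, fun w => ?_⟩
    · intro h0
      exact h12 ⟨by simpa using congrArg Prod.snd h0, congrArg Prod.fst h0⟩
    · rw [hD, show (c2 * c1 + -c1 * c2) * w.1 + (c2 * c2 + -c1 * c3) * w.2 = 0 by
        linear_combination -w.2 * hdet, zero_smul]

theorem dirDeriv_inner_const {F : ℝ × ℝ → E3} (hF : ContDiff ℝ ∞ F) (m : E3) (v : ℝ × ℝ) :
    dirDeriv v (fun q => (inner ℝ m (F q) : ℝ)) = fun q => inner ℝ m (dirDeriv v F q) := by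
  funext q
  rw [dirDeriv_inner contDiff_const hF, dirDeriv_const]
  simp

/-- The null direction at a non-flat point `p` spans a line all of whose points in the strip are
non-flat, and along which the second derivative vanishes. -/
theorem exists_ruling_direction (h : IsPaperBand lam f) {p : ℝ × ℝ} (hp : p ∈ openStrip)
    (hflat : ¬ Flat f p) :
    ∃ v : ℝ × ℝ, v ≠ 0 ∧ ∀ s : ℝ, p + s • v ∈ openStrip →
      ¬ Flat f (p + s • v) ∧ dirDeriv v (dirDeriv v (unc f)) (p + s • v) = 0 := by
  obtain ⟨v, hv0, hv⟩ := h.exists_kernel hp hflat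
  refine ⟨v, hv0, ?_⟩
  set w : ℝ × ℝ := (-v.2, v.1) with hw
  have hvw : v.1 * w.2 - v.2 * w.1 ≠ 0 := by
    intro h0
    apply hv0
    simp only [hw] at h0
    ext
    · simp only [Prod.fst_zero]; nlinarith [sq_nonneg v.1, sq_nonneg v.2]
    · simp only [Prod.snd_zero]; nlinarith [sq_nonneg v.1, sq_nonneg v.2]
  set m : E3 := dirDeriv w (dirDeriv w (unc f)) p with hm
  have hm0 : m ≠ 0 := fun h0 => hflat (h.flat_of_basis hvw (hv v) (hv w) h0)
  have hF := h.contDiff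
  have hu : ContDiff ℝ ∞ (fun q => (inner ℝ m (unc f q) : ℝ)) := contDiff_const.inner ℝ hF
  have hsnd : ∀ y z : ℝ × ℝ, dirDeriv y (dirDeriv z (fun q => (inner ℝ m (unc f q) : ℝ)))
      = fun q => inner ℝ m (dirDeriv y (dirDeriv z (unc f)) q) := by
    intro y z
    rw [dirDeriv_inner_const hF, dirDeriv_inner_const (contDiff_dirDeriv hF z)]
  -- one half-line at a time
  have main : ∀ v' : ℝ × ℝ, (∀ z, dirDeriv v' (dirDeriv z (unc f)) p = 0) →
      ∀ s : ℝ, 0 ≤ s → p + s • v' ∈ openStrip →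
      ¬ Flat f (p + s • v') ∧ dirDeriv v' (dirDeriv v' (unc f)) (p + s • v') = 0 := by
    intro v' hv' s hs hps
    have hseg : ∀ r ∈ Set.Icc 0 s, p + r • v' ∈ openStrip := by
      intro r hr
      simp only [openStrip, Set.mem_ofPred_eq, Set.mem_Ioo, Prod.snd_add, Prod.smul_snd,
        smul_eq_mul] at hp hps ⊢
      rcases le_total 0 v'.2 with h0 | h0
      · constructor <;> nlinarith [hr.1, hr.2, mul_nonneg hr.1 h0,
          mul_nonneg (sub_nonneg.2 hr.2) h0]
      · constructor <;> nlinarith [hr.1, hr.2, mul_nonneg hr.1 (neg_nonneg.2 h0),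
          mul_nonneg (sub_nonneg.2 hr.2) (neg_nonneg.2 h0)]
    have key := hessian_kernel_along_line hu isOpen_openStrip v' w
      (by
        intro q hq
        simp only [hsnd]
        exact h.component_hessian_det hq m v' w)
      p hseg (by simp only [hsnd, hv', inner_zero_right])
      (by simp only [hsnd, ← hm]; simpa using hm0) s ⟨hs, le_rfl⟩
    simp only [hsnd] at key
    obtain ⟨k1, -, k3⟩ := key
    refine ⟨fun hfl => k1 (by rw [hfl w w, inner_zero_right]), ?_⟩
    obtain ⟨n, hn⟩ := h.exists_normal_second hps
    obtain ⟨c, hc⟩ := hn v' v'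
    obtain ⟨c', hc'⟩ := hn w w
    rw [hc', real_inner_smul_right] at k1
    rw [hc, real_inner_smul_right] at k3
    rw [hc]
    rcases mul_eq_zero.1 k3 with h0 | h0
    · rw [h0, zero_smul]
    · exact absurd (by rw [h0, mul_zero]) k1
  intro s hps
  rcases le_total 0 s with hs | hs
  · exact main v hv s hs hps
  · have hneg : ∀ z q, dirDeriv (-v) (dirDeriv z (unc f)) q = -dirDeriv v (dirDeriv z (unc f)) q := by
      intro z q; simp [dirDeriv]
    have e : p + s • v = p + (-s) • (-v) := by simp
    have := main (-v) (fun z => by rw [hneg, hv, neg_zero]) (-s) (by linarith) (e ▸ hps)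
    rw [← e] at this
    refine ⟨this.1, ?_⟩
    have h2 := this.2
    rw [hneg, dirDeriv_comm hF, hneg, neg_neg] at h2
    exact h2

end IsPaperBand

theorem norm_sub_combo_sq {W : Type*} [NormedAddCommGroup W] [InnerProductSpace ℝ W]
    (q X Y : W) (r : ℝ) :
    ‖q - (X + r • (Y - X))‖ ^ 2
      = (1 - r) * ‖q - X‖ ^ 2 + r * ‖q - Y‖ ^ 2 - r * (1 - r) * ‖Y - X‖ ^ 2 := by
  have e1 : q - (X + r • (Y - X)) = (q - X) - r • (Y - X) := by abel
  have e2 : q - Y = (q - X) - (Y - X) := by abel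
  rw [e1, e2]
  generalize q - X = A
  generalize Y - X = B
  rw [norm_sub_sq_real, norm_sub_sq_real, norm_smul, real_inner_smul_right, mul_pow,
    Real.norm_eq_abs, sq_abs]
  ring

/-- The full-length chord condition: `f` maps the segment from `(a, 0)` to `(b, 1)` isometrically
onto a straight segment. -/
def IsBend (f : ℝ → ℝ → E3) (a b : ℝ) : Prop := ‖f b 1 - f a 0‖ ^ 2 = 1 + (b - a) ^ 2

namespace IsPaperBand

variable {lam : ℝ} {f : ℝ → ℝ → E3}

theorem periodic (h : IsPaperBand lam f) {y : ℝ} (hy : y ∈ Set.Icc (0 : ℝ) 1) :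
    Function.Periodic (fun x => f x y) (2 * lam) := by
  intro x
  have hy' : 1 - y ∈ Set.Icc (0 : ℝ) 1 := ⟨by linarith [hy.2], by linarith [hy.1]⟩
  have h1 := h.glue (x + lam) (1 - y) hy'
  have h2 := h.glue x y hy
  simp only [sub_sub_cancel] at h1
  change f (x + 2 * lam) y = f x y
  rw [← h2, ← h1]
  ring_nf

theorem continuous (h : IsPaperBand lam f) : Continuous (unc f) := h.contDiff.continuous

theorem exists_bound (h : IsPaperBand lam f) :
    ∃ M : ℝ, ∀ x y : ℝ, y ∈ Set.Icc (0 : ℝ) 1 → ‖f x y‖ ≤ M := by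
  obtain ⟨M, hM⟩ := (isCompact_Icc (a := (0 : ℝ)) (b := 2 * lam)).prod
    (isCompact_Icc (a := (0 : ℝ)) (b := 1)) |>.exists_bound_of_continuousOn h.continuous.continuousOn
  refine ⟨M, fun x y hy => ?_⟩
  obtain ⟨x', hx', he⟩ := (h.periodic hy).exists_mem_Ico₀ (by linarith [h.pos]) x
  change f x y = f x' y at he
  rw [he]
  exact hM (x', y) ⟨⟨hx'.1, hx'.2.le⟩, hy⟩

theorem norm_sub_le (h : IsPaperBand lam f) {x y x' y' : ℝ} (hy : y ∈ Set.Icc (0 : ℝ) 1)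
    (hy' : y' ∈ Set.Icc (0 : ℝ) 1) :
    ‖f x' y' - f x y‖ ≤ Real.sqrt ((x' - x) ^ 2 + (y' - y) ^ 2) := by
  set p : ℝ × ℝ := (x, y)
  set v : ℝ × ℝ := (x' - x, y' - y)
  have key := norm_image_sub_le_of_norm_deriv_le_segment_01'
    (f := fun s : ℝ => unc f (p + s • v)) (f' := fun s => dirDeriv v (unc f) (p + s • v))
    (C := Real.sqrt ((x' - x) ^ 2 + (y' - y) ^ 2))
    (fun s _ => (hasDerivAt_line h.contDiff p v s).hasDerivWithinAt)
    (fun s hs => by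
      rw [h.norm_dirDeriv]
      simp only [p, v, Prod.snd_add, Prod.smul_snd, smul_eq_mul]
      constructor <;> nlinarith [hs.1, hs.2, hy.1, hy.2, hy'.1, hy'.2])
  simpa [unc, p, v] using key

theorem norm_sub_sq_le (h : IsPaperBand lam f) {x y x' y' : ℝ} (hy : y ∈ Set.Icc (0 : ℝ) 1)
    (hy' : y' ∈ Set.Icc (0 : ℝ) 1) :
    ‖f x' y' - f x y‖ ^ 2 ≤ (x' - x) ^ 2 + (y' - y) ^ 2 := by
  have := pow_le_pow_left₀ (norm_nonneg _) (h.norm_sub_le (x := x) (x' := x') hy hy') 2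
  rwa [Real.sq_sqrt (by positivity)] at this

/-- If the chord between the images of two points has full length, then `f` is affine on the
segment between them. -/
theorem affine_of_full_chord (h : IsPaperBand lam f) {x y x' y' : ℝ}
    (hy : y ∈ Set.Icc (0 : ℝ) 1) (hy' : y' ∈ Set.Icc (0 : ℝ) 1)
    (hd : ‖f x' y' - f x y‖ ^ 2 = (x' - x) ^ 2 + (y' - y) ^ 2)
    {r : ℝ} (hr : r ∈ Set.Icc (0 : ℝ) 1) :
    f (x + r * (x' - x)) (y + r * (y' - y)) = f x y + r • (f x' y' - f x y) := by
  have hy'' : y + r * (y' - y) ∈ Set.Icc (0 : ℝ) 1 := by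
    constructor <;> nlinarith [hr.1, hr.2, hy.1, hy.2, hy'.1, hy'.2]
  have h1 := h.norm_sub_sq_le (x := x) (x' := x + r * (x' - x)) hy hy''
  have h2 := h.norm_sub_sq_le (x := x') (x' := x + r * (x' - x)) hy' hy''
  have h3 := norm_sub_combo_sq (f (x + r * (x' - x)) (y + r * (y' - y))) (f x y) (f x' y') r
  have h4 : ‖f (x + r * (x' - x)) (y + r * (y' - y)) - (f x y + r • (f x' y' - f x y))‖ ^ 2 ≤ 0 := by
    rw [h3, hd]
    nlinarith [mul_le_mul_of_nonneg_left h1 (sub_nonneg.2 hr.2), mul_le_mul_of_nonneg_left h2 hr.1]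
  have h5 : ‖f (x + r * (x' - x)) (y + r * (y' - y)) - (f x y + r • (f x' y' - f x y))‖ = 0 :=
    pow_eq_zero_iff (two_ne_zero) |>.1 (le_antisymm h4 (sq_nonneg _))
  exact sub_eq_zero.1 (norm_eq_zero.1 h5)

theorem bend_point (h : IsPaperBand lam f) {a b : ℝ} (hab : IsBend f a b)
    {r : ℝ} (hr : r ∈ Set.Icc (0 : ℝ) 1) :
    f (a + r * (b - a)) r = f a 0 + r • (f b 1 - f a 0) := by
  have := h.affine_of_full_chord (x := a) (x' := b) (y := 0) (y' := 1) (by simp) (by simp)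
    (by rw [hab]; ring) hr
  simpa using this

theorem bend_dirDeriv (h : IsPaperBand lam f) {a b : ℝ} (hab : IsBend f a b)
    {r : ℝ} (hr : r ∈ Set.Icc (0 : ℝ) 1) :
    dirDeriv (b - a, 1) (unc f) (a + r * (b - a), r) = f b 1 - f a 0 := by
  have h1 := (hasDerivAt_line h.contDiff (a, 0) (b - a, 1) r).hasDerivWithinAt
    (s := Set.Icc (0 : ℝ) 1)
  have h2 : HasDerivWithinAt (fun s : ℝ => f a 0 + s • (f b 1 - f a 0)) (f b 1 - f a 0)
      (Set.Icc (0 : ℝ) 1) r := by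
    simpa using (((hasDerivAt_id r).smul_const (f b 1 - f a 0)).const_add (f a 0)).hasDerivWithinAt
  have h3 := h2.congr_of_mem (f₁ := fun s : ℝ => unc f ((a, 0) + s • (b - a, 1)))
    (fun s hs => by simpa [unc] using h.bend_point hab hs) hr
  have := (uniqueDiffOn_Icc (zero_lt_one' ℝ) r hr).eq_deriv _ h1 h3
  simpa using this

theorem bend_second_dirDeriv (h : IsPaperBand lam f) {a b : ℝ} (hab : IsBend f a b)
    {r : ℝ} (hr : r ∈ Set.Ioo (0 : ℝ) 1) :
    dirDeriv (b - a, 1) (dirDeriv (b - a, 1) (unc f)) (a + r * (b - a), r) = 0 := by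
  have h1 := hasDerivAt_line (contDiff_dirDeriv h.contDiff (b - a, 1)) (a, 0) (b - a, 1) r
  have h2 : (fun s : ℝ => dirDeriv (b - a, 1) (unc f) ((a, 0) + s • (b - a, 1)))
      =ᶠ[nhds r] fun _ => f b 1 - f a 0 := by
    filter_upwards [Ioo_mem_nhds hr.1 hr.2] with s hs
    simpa using h.bend_dirDeriv hab ⟨hs.1.le, hs.2.le⟩
  have := (h2.hasDerivAt_iff.1 h1).unique (hasDerivAt_const r _)
  simpa using this

theorem bend_inner_of_meet (h : IsPaperBand lam f) {a b a' b' : ℝ} (hab : IsBend f a b)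
    (hab' : IsBend f a' b') {r : ℝ} (hr : r ∈ Set.Icc (0 : ℝ) 1)
    (hmeet : a + r * (b - a) = a' + r * (b' - a')) :
    inner ℝ (f b 1 - f a 0) (f b' 1 - f a' 0) = 1 + (b - a) * (b' - a') := by
  rw [← h.bend_dirDeriv hab hr, ← h.bend_dirDeriv hab' hr, hmeet, h.inner_dirDeriv (by simpa using hr)]
  ring

/-- Two bends which meet span a planar quadrilateral, so all segments between their endpoints are
bends. -/
theorem bend_rectangle (h : IsPaperBand lam f) {a b a' b' c d : ℝ} (hab : IsBend f a b)
    (hab' : IsBend f a' b') (hc : c ∈ Set.Icc a a') (hd : d ∈ Set.Icc b' b) : IsBend f c d := by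
  have haa : a ≤ a' := hc.1.trans hc.2
  have hbb : b' ≤ b := hd.1.trans hd.2
  by_cases hdeg : a = a' ∧ b = b'
  · obtain ⟨rfl, rfl⟩ := hdeg
    rw [le_antisymm hc.2 hc.1, le_antisymm hd.2 hd.1]
    exact hab
  have hw : 0 < (a' - a) + (b - b') := by
    rcases haa.lt_or_eq with h1 | h1
    · linarith
    · rcases hbb.lt_or_eq with h2 | h2
      · linarith
      · exact absurd ⟨h1, h2.symm⟩ hdeg
  set r := (a' - a) / ((a' - a) + (b - b')) with hrdef
  have hr_mul : r * ((a' - a) + (b - b')) = a' - a := div_mul_cancel₀ _ hw.ne'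
  have hr : r ∈ Set.Icc (0 : ℝ) 1 :=
    ⟨div_nonneg (by linarith) hw.le, by rw [hrdef, div_le_one hw]; linarith⟩
  have hmeet : a + r * (b - a) = a' + r * (b' - a') := by linarith
  have hin := h.bend_inner_of_meet hab hab' hr hmeet
  have hO := h.bend_point hab hr
  have hO' := h.bend_point hab' hr
  rw [hmeet] at hO
  have hUU : ‖f b 1 - f a 0‖ ^ 2 = 1 + (b - a) ^ 2 := hab
  have hUU' : ‖f b' 1 - f a' 0‖ ^ 2 = 1 + (b' - a') ^ 2 := hab'
  have ha0 : f a 0 = f (a' + r * (b' - a')) r - r • (f b 1 - f a 0) := by rw [hO]; abel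
  have ha'0 : f a' 0 = f (a' + r * (b' - a')) r - r • (f b' 1 - f a' 0) := by rw [hO']; abel
  have hb1 : f b 1 = f (a' + r * (b' - a')) r + (1 - r) • (f b 1 - f a 0) := by
    rw [hO]; module
  have hb'1 : f b' 1 = f (a' + r * (b' - a')) r + (1 - r) • (f b' 1 - f a' 0) := by
    rw [hO']; module
  set U := f b 1 - f a 0 with hU
  set U' := f b' 1 - f a' 0 with hU'
  set O := f (a' + r * (b' - a')) r
  have hdiff : ‖U - U'‖ ^ 2 = ((b - a) - (b' - a')) ^ 2 := by
    rw [norm_sub_sq_real, hUU, hUU', hin]; ring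
  have hs1 : a' - a = r * ((b - a) - (b' - a')) := by linarith
  have hs2 : b - b' = (1 - r) * ((b - a) - (b' - a')) := by linarith
  have hsplit : ∀ {l u z : ℝ}, z ∈ Set.Icc l u → ∃ t ∈ Set.Icc (0 : ℝ) 1, z = l + t * (u - l) := by
    intro l u z hz
    rcases (hz.1.trans hz.2).lt_or_eq with hlt | heq
    · refine ⟨(z - l) / (u - l), ⟨div_nonneg (by linarith [hz.1]) (by linarith), ?_⟩, ?_⟩
      · rw [div_le_one (by linarith)]; linarith [hz.2]
      · rw [div_mul_cancel₀ _ (by linarith)]; ring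
    · exact ⟨0, by simp, by linarith [hz.1, hz.2]⟩
  obtain ⟨t, ht, hct⟩ := hsplit hc
  obtain ⟨t', ht', hdt⟩ := hsplit hd
  have hbot : f c 0 = f a 0 + t • (f a' 0 - f a 0) := by
    have := h.affine_of_full_chord (x := a) (x' := a') (y := 0) (y' := 0) (by simp) (by simp)
      (by
        have : f a' 0 - f a 0 = r • (U - U') := by
          rw [ha0, ha'0]; module
        rw [this, norm_smul, mul_pow, hdiff, Real.norm_eq_abs, sq_abs, hs1]; ring) ht
    rw [hct]; simpa using this
  have htop : f d 1 = f b' 1 + t' • (f b 1 - f b' 1) := by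
    have := h.affine_of_full_chord (x := b') (x' := b) (y := 1) (y' := 1) (by simp) (by simp)
      (by
        have : f b 1 - f b' 1 = (1 - r) • (U - U') := by
          rw [hb1, hb'1]; module
        rw [this, norm_smul, mul_pow, hdiff, Real.norm_eq_abs, sq_abs, hs2]; ring) ht'
    rw [hdt]; simpa using this
  set k := r + t' * (1 - r) - t * r with hk
  have hvec : f d 1 - f c 0 = k • U + (1 - k) • U' := by
    rw [hbot, htop, ha0, ha'0, hb1, hb'1]
    module
  have hdc : d - c = k * (b - a) + (1 - k) * (b' - a') := by
    rw [hct, hdt, hs1, hs2]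
    linear_combination hs1
  unfold IsBend
  rw [hvec, hdc, norm_add_sq_real, norm_smul, norm_smul, mul_pow, mul_pow, hUU, hUU',
    real_inner_smul_left, real_inner_smul_right, hin, Real.norm_eq_abs, Real.norm_eq_abs, sq_abs,
    sq_abs]
  ring

theorem bend_of_second_dirDeriv (h : IsPaperBand lam f) (a σ : ℝ)
    (hz : ∀ r ∈ Set.Ioo (0 : ℝ) 1,
      dirDeriv (σ, 1) (dirDeriv (σ, 1) (unc f)) ((a, 0) + r • (σ, 1)) = 0) :
    IsBend f a (a + σ) := by
  have hF1 := contDiff_dirDeriv h.contDiff (σ, 1)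
  have hF2 := contDiff_dirDeriv hF1 (σ, 1)
  have cont : ∀ {G : ℝ × ℝ → E3}, ContDiff ℝ ∞ G →
      Continuous (fun s : ℝ => G ((a, 0) + s • (σ, 1))) :=
    fun hG => hG.continuous.comp (by fun_prop)
  have hz' : ∀ r ∈ Set.Icc (0 : ℝ) 1,
      dirDeriv (σ, 1) (dirDeriv (σ, 1) (unc f)) ((a, 0) + r • (σ, 1)) = 0 := by
    intro r hr
    have := Set.EqOn.closure (s := Set.Ioo (0 : ℝ) 1)
      (f := fun r : ℝ => dirDeriv (σ, 1) (dirDeriv (σ, 1) (unc f)) ((a, 0) + r • (σ, 1)))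
      (g := fun _ => 0) hz (cont hF2) continuous_const
    rw [closure_Ioo (zero_ne_one)] at this
    exact this hr
  set W := dirDeriv (σ, 1) (unc f) (a, 0) with hW
  have h1 : ∀ r ∈ Set.Icc (0 : ℝ) 1, dirDeriv (σ, 1) (unc f) ((a, 0) + r • (σ, 1)) = W := by
    intro r hr
    have := constant_of_has_deriv_right_zero (cont hF1).continuousOn
      (fun x hx => by
        have := (hasDerivAt_line hF1 (a, 0) (σ, 1) x).hasDerivWithinAt (s := Set.Ici x)
        rwa [hz' x ⟨hx.1, hx.2.le⟩] at this) r hr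
    simpa using this
  have h2 := constant_of_has_deriv_right_zero (a := (0 : ℝ)) (b := 1)
    (f := fun r : ℝ => unc f ((a, 0) + r • (σ, 1)) - r • W)
    (((cont h.contDiff).sub (by fun_prop)).continuousOn)
    (fun x hx => by
      have := ((hasDerivAt_line h.contDiff (a, 0) (σ, 1) x).fun_sub
        ((hasDerivAt_id x).smul_const W)).hasDerivWithinAt (s := Set.Ici x)
      rw [h1 x ⟨hx.1, hx.2.le⟩] at this
      simpa using this) 1 (by simp)
  simp only [unc, one_smul, zero_smul, add_zero, sub_zero, Prod.fst_add, Prod.snd_add,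
    zero_add] at h2
  have h3 : f (a + σ) 1 - f a 0 = W := by rw [← h2]; abel
  unfold IsBend
  rw [h3, hW, h.norm_dirDeriv (by simp), Real.sq_sqrt (by positivity)]
  ring

theorem not_straight_line (h : IsPaperBand lam f) (p : ℝ × ℝ) (hp : p.2 ∈ Set.Icc (0 : ℝ) 1)
    {t : ℝ} (ht : t ≠ 0)
    (hz : ∀ s : ℝ, dirDeriv (t, 0) (dirDeriv (t, 0) (unc f)) (p + s • (t, 0)) = 0) : False := by
  have hF1 := contDiff_dirDeriv h.contDiff (t, 0)
  have h1 : ∀ s : ℝ, dirDeriv (t, 0) (unc f) (p + s • (t, 0)) = dirDeriv (t, 0) (unc f) p := by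
    intro s
    have := is_const_of_deriv_eq_zero
      (f := fun s : ℝ => dirDeriv (t, 0) (unc f) (p + s • (t, 0)))
      (fun x => (hasDerivAt_line hF1 p (t, 0) x).differentiableAt)
      (fun x => by rw [(hasDerivAt_line hF1 p (t, 0) x).deriv, hz]) s 0
    simpa using this
  set W := dirDeriv (t, 0) (unc f) p
  have hd : ∀ s : ℝ, HasDerivAt (fun r : ℝ => unc f (p + r • (t, 0)) - r • W) 0 s := by
    intro x
    have := (hasDerivAt_line h.contDiff p (t, 0) x).fun_sub ((hasDerivAt_id x).smul_const W)
    rw [h1 x] at this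
    simpa using this
  have h2 : ∀ s : ℝ, unc f (p + s • (t, 0)) - s • W = unc f p := by
    intro s
    have := is_const_of_deriv_eq_zero (fun x => (hd x).differentiableAt) (fun x => (hd x).deriv) s 0
    simpa using this
  obtain ⟨M, hM⟩ := h.exists_bound
  have hWn : ‖W‖ = |t| := by
    rw [show ‖W‖ = _ from h.norm_dirDeriv hp (t, 0)]
    simp [Real.sqrt_sq_eq_abs]
  have htp : 0 < |t| := abs_pos.2 ht
  have hM0 : 0 ≤ M := (norm_nonneg _).trans (hM p.1 p.2 hp)
  set s := (2 * M + 1) / |t|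
  have h3 : s • W = unc f (p + s • (t, 0)) - unc f p := by rw [← h2 s]; abel
  have h4 : ‖s • W‖ = 2 * M + 1 := by
    rw [norm_smul, hWn, Real.norm_eq_abs, abs_of_nonneg (by positivity), div_mul_cancel₀ _ htp.ne']
  have h5 := _root_.norm_sub_le (unc f (p + s • (t, 0))) (unc f p)
  have h6 : ‖unc f (p + s • (t, 0))‖ ≤ M := hM _ _ (by simpa using hp)
  have h7 : ‖unc f p‖ ≤ M := hM _ _ hp
  rw [← h3, h4] at h5
  linarith

/-- Through every non-flat point passes a bend consisting of non-flat points. -/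
theorem exists_bend_of_not_flat (h : IsPaperBand lam f) {p : ℝ × ℝ} (hp : p ∈ openStrip)
    (hflat : ¬ Flat f p) :
    ∃ a b : ℝ, IsBend f a b ∧ p.1 = a + p.2 * (b - a) ∧
      ∀ r ∈ Set.Ioo (0 : ℝ) 1, ¬ Flat f (a + r * (b - a), r) := by
  obtain ⟨v, hv0, hv⟩ := h.exists_ruling_direction hp hflat
  have hv2 : v.2 ≠ 0 := by
    intro h0
    have hv1 : v.1 ≠ 0 := fun h1 => hv0 (Prod.ext h1 h0)
    have hveq : v = (v.1, 0) := Prod.ext rfl h0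
    refine h.not_straight_line p (openStrip_le hp) hv1 (fun s => ?_)
    rw [← hveq]
    refine (hv s ?_).2
    rw [hveq]
    simpa [openStrip] using hp
  set σ := v.1 / v.2 with hσ
  set a := p.1 - p.2 * σ with ha
  have hveq : v = v.2 • (σ, 1) := by
    ext <;> simp [hσ]
    field_simp
  have hpt : ∀ r : ℝ, (a + r * σ, r) = p + ((r - p.2) / v.2) • v := by
    intro r
    ext
    · simp only [Prod.fst_add, Prod.smul_fst, smul_eq_mul, ha, hσ]; field_simp; ring
    · simp only [Prod.snd_add, Prod.smul_snd, smul_eq_mul]; field_simp; ring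
  have hgood : ∀ r ∈ Set.Ioo (0 : ℝ) 1, ¬ Flat f (a + r * σ, r) ∧
      dirDeriv (σ, 1) (dirDeriv (σ, 1) (unc f)) (a + r * σ, r) = 0 := by
    intro r hr
    have hmem : p + ((r - p.2) / v.2) • v ∈ openStrip := by rw [← hpt]; exact hr
    obtain ⟨h1, h2⟩ := hv _ hmem
    rw [← hpt] at h1 h2
    refine ⟨h1, ?_⟩
    rw [hveq, dirDeriv_dirDeriv_apply h.contDiff, map_smul, map_smul, smul_apply,
      ← dirDeriv_dirDeriv_apply h.contDiff] at h2
    simpa [hv2] using h2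
  refine ⟨a, a + σ, h.bend_of_second_dirDeriv a σ (fun r hr => ?_), by simp [ha], fun r hr => ?_⟩
  · simpa using (hgood r hr).2
  · simpa using (hgood r hr).1

end IsPaperBand

namespace IsPaperBand

variable {lam : ℝ} {f : ℝ → ℝ → E3}

theorem flat_shift {c : ℝ} (hc : ∀ y ∈ Set.Icc (0 : ℝ) 1, Function.Periodic (fun x => f x y) c)
    {p : ℝ × ℝ} (hp : p ∈ openStrip) (hflat : Flat f (p + (c, 0))) : Flat f p := by
  have shift : ∀ (G : ℝ × ℝ → E3) (v q : ℝ × ℝ),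
      dirDeriv v (fun z => G (z + (c, 0))) q = dirDeriv v G (q + (c, 0)) := by
    intro G v q
    simp only [dirDeriv, fderiv_comp_add_right]
  have hev : ∀ q ∈ openStrip, unc f =ᶠ[nhds q] fun z => unc f (z + (c, 0)) := by
    intro q hq
    filter_upwards [isOpen_openStrip.mem_nhds hq] with z hz
    have := hc _ (openStrip_le hz) z.1
    simpa [unc] using this.symm
  intro v w
  have h1 : ∀ q ∈ openStrip, dirDeriv w (unc f) q = dirDeriv w (unc f) (q + (c, 0)) := by
    intro q hq
    rw [← shift]
    simp only [dirDeriv]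
    rw [(hev q hq).fderiv_eq]
  have h2 : dirDeriv w (unc f) =ᶠ[nhds p] fun z => dirDeriv w (unc f) (z + (c, 0)) := by
    filter_upwards [isOpen_openStrip.mem_nhds hp] with z hz using h1 z hz
  have h3 : dirDeriv v (dirDeriv w (unc f)) p
      = dirDeriv v (fun z => dirDeriv w (unc f) (z + (c, 0))) p := by
    simp only [dirDeriv] at h2 ⊢
    rw [h2.fderiv_eq]
  rw [h3, shift]
  exact hflat v w

/-- A bend made of non-flat points crosses no other bend. -/
theorem bend_not_cross (h : IsPaperBand lam f) {a b a' b' : ℝ} (hab : IsBend f a b)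
    (hnf : ∀ r ∈ Set.Ioo (0 : ℝ) 1, ¬ Flat f (a + r * (b - a), r)) (hab' : IsBend f a' b') :
    (a' - a) * (b - b') ≤ 0 := by
  by_contra! hpos
  have hw : (a' - a) + (b - b') ≠ 0 := by
    intro h0
    rw [show a' - a = -(b - b') by linarith] at hpos
    nlinarith [sq_nonneg (b - b')]
  set r := (a' - a) / ((a' - a) + (b - b')) with hr
  have hr_mul : r * ((a' - a) + (b - b')) = a' - a := div_mul_cancel₀ _ hw
  have hr_mul' : (1 - r) * ((a' - a) + (b - b')) = b - b' := by linarith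
  have hsq : 0 < ((a' - a) + (b - b')) ^ 2 := by positivity
  have hrr : 0 < r * (1 - r) := by
    by_contra hcon
    have : r * (1 - r) * ((a' - a) + (b - b')) ^ 2 = (a' - a) * (b - b') := by
      linear_combination ((1 - r) * ((a' - a) + (b - b'))) * hr_mul + (a' - a) * hr_mul'
    nlinarith
  have hr01 : r ∈ Set.Ioo (0 : ℝ) 1 := by
    constructor <;> nlinarith [sq_nonneg r, sq_nonneg (1 - r)]
  have hmeet : a' + r * (b' - a') = a + r * (b - a) := by linarith
  refine hnf r hr01 (h.flat_of_two_straight (v := (b - a, 1)) (w := (b' - a', 1)) hr01 ?_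
    (h.bend_second_dirDeriv hab hr01) ?_)
  · intro h0
    apply hw
    simp only at h0
    linarith
  · rw [← hmeet]
    exact h.bend_second_dirDeriv hab' hr01

/-- A bend made of non-flat points and any other bend are weakly ordered in the same way along all
horizontal lines. -/
theorem bend_le_of_midpoint_le (h : IsPaperBand lam f) {a b a' b' : ℝ} (hab : IsBend f a b)
    (hnf : ∀ r ∈ Set.Ioo (0 : ℝ) 1, ¬ Flat f (a + r * (b - a), r)) (hab' : IsBend f a' b')
    (hm : a + b ≤ a' + b') : a ≤ a' ∧ b ≤ b' := by
  have key := h.bend_not_cross hab hnf hab'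
  constructor
  · by_contra! hlt
    linarith [mul_pos_of_neg_of_neg (show a' - a < 0 by linarith) (show b - b' < 0 by linarith)]
  · by_contra! hlt
    linarith [mul_pos (show 0 < a' - a by linarith) (show 0 < b - b' by linarith)]

theorem bend_le_of_le_midpoint (h : IsPaperBand lam f) {a b a' b' : ℝ} (hab : IsBend f a b)
    (hnf : ∀ r ∈ Set.Ioo (0 : ℝ) 1, ¬ Flat f (a + r * (b - a), r)) (hab' : IsBend f a' b')
    (hm : a' + b' ≤ a + b) : a' ≤ a ∧ b' ≤ b := by
  have key := h.bend_not_cross hab hnf hab'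
  constructor
  · by_contra! hlt
    linarith [mul_pos (show 0 < a' - a by linarith) (show 0 < b - b' by linarith)]
  · by_contra! hlt
    linarith [mul_pos_of_neg_of_neg (show a' - a < 0 by linarith) (show b - b' < 0 by linarith)]

theorem bend_between (h : IsPaperBand lam f) {a₁ b₁ a₂ b₂ x : ℝ} (h₁ : IsBend f a₁ b₁)
    (h₂ : IsBend f a₂ b₂) (hx₁ : a₁ + b₁ < 2 * x) (hx₂ : 2 * x < a₂ + b₂)
    (hgap : ∀ z, a₁ + b₁ < 2 * z → 2 * z < a₂ + b₂ → Flat f (z, 1 / 2)) :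
    ∃ c d, IsBend f c d ∧ c + d = 2 * x := by
  set t := (2 * x - (a₁ + b₁)) / ((a₂ + b₂) - (a₁ + b₁)) with ht
  have hden : 0 < (a₂ + b₂) - (a₁ + b₁) := by linarith
  have ht_mul : t * ((a₂ + b₂) - (a₁ + b₁)) = 2 * x - (a₁ + b₁) := div_mul_cancel₀ _ hden.ne'
  have ht0 : 0 < t := div_pos (by linarith) hden
  have ht1 : t < 1 := by rw [ht, div_lt_one hden]; linarith
  set c := a₁ + t * (a₂ - a₁) with hc
  set d := b₁ + t * (b₂ - b₁) with hd
  have hcd : c + d = 2 * x := by linarith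
  refine ⟨c, d, ?_, hcd⟩
  rcases lt_or_ge a₂ a₁ with ha | ha
  · exact h.bend_rectangle h₂ h₁ ⟨by nlinarith, by nlinarith⟩ ⟨by nlinarith, by nlinarith⟩
  rcases lt_or_ge b₂ b₁ with hb | hb
  · exact h.bend_rectangle h₁ h₂ ⟨by nlinarith, by nlinarith⟩ ⟨by nlinarith, by nlinarith⟩
  have hc1 : a₁ ≤ c := by nlinarith
  have hc2 : c ≤ a₂ := by nlinarith
  have hd1 : b₁ ≤ d := by nlinarith
  have hd2 : d ≤ b₂ := by nlinarith
  have hflat : ∀ r ∈ Set.Ioo (0 : ℝ) 1, Flat f (c + r * (d - c), r) := by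
    intro r hr
    by_contra hnf
    obtain ⟨a, b, hab, hpt, hnfab⟩ := h.exists_bend_of_not_flat (p := (c + r * (d - c), r)) hr hnf
    simp only at hpt
    have hr0 := hr.1
    have hr1 : 0 < 1 - r := by linarith [hr.2]
    have hmid : ¬ (a₁ + b₁ < a + b ∧ a + b < a₂ + b₂) := by
      rintro ⟨hl, hu⟩
      have := hgap ((a + b) / 2) (by linarith) (by linarith)
      refine hnfab (1 / 2) (by norm_num) ?_
      convert this using 2
      ring
    rcases le_or_gt (a + b) (a₁ + b₁) with hle | hgt
    · obtain ⟨h3, h4⟩ := h.bend_le_of_midpoint_le hab hnfab h₁ hle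
      have h5 : (1 - r) * (c - a) + r * (d - b) = 0 := by linarith
      have h6 := mul_nonneg hr1.le (by linarith : 0 ≤ c - a)
      have h7 := mul_nonneg hr0.le (by linarith : 0 ≤ d - b)
      have h8 : c - a = 0 := by
        rcases mul_eq_zero.1 (by linarith : (1 - r) * (c - a) = 0) with h | h <;> linarith
      have h9 : d - b = 0 := by
        rcases mul_eq_zero.1 (by linarith : r * (d - b) = 0) with h | h <;> linarith
      linarith
    · have hge : a₂ + b₂ ≤ a + b := by
        by_contra! hlt
        exact hmid ⟨hgt, hlt⟩
      obtain ⟨h3, h4⟩ := h.bend_le_of_le_midpoint hab hnfab h₂ hge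
      have h5 : (1 - r) * (a - c) + r * (b - d) = 0 := by linarith
      have h6 := mul_nonneg hr1.le (by linarith : 0 ≤ a - c)
      have h7 := mul_nonneg hr0.le (by linarith : 0 ≤ b - d)
      have h8 : a - c = 0 := by
        rcases mul_eq_zero.1 (by linarith : (1 - r) * (a - c) = 0) with h | h <;> linarith
      have h9 : b - d = 0 := by
        rcases mul_eq_zero.1 (by linarith : r * (b - d) = 0) with h | h <;> linarith
      linarith
  have := h.bend_of_second_dirDeriv c (d - c) (fun r hr => by
    have := hflat r hr (d - c, 1) (d - c, 1)
    simpa using this)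
  simpa using this

theorem bend_slope_bounded (h : IsPaperBand lam f) :
    ∃ K : ℝ, ∀ x σ : ℝ, IsBend f (x - σ / 2) (x + σ / 2) → σ ∈ Set.Icc (-K) K := by
  obtain ⟨M, hM⟩ := h.exists_bound
  refine ⟨2 * M, fun x σ hb => abs_le.1 (abs_le_of_sq_le_sq ?_ ?_)⟩
  · unfold IsBend at hb
    have h1 := _root_.norm_sub_le (f (x + σ / 2) 1) (f (x - σ / 2) 0)
    have h2 := hM (x + σ / 2) 1 (by simp)
    have h3 := hM (x - σ / 2) 0 (by simp)
    have h4 := pow_le_pow_left₀ (norm_nonneg _) (h1.trans (add_le_add h2 h3)) 2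
    rw [hb] at h4
    ring_nf at h4 ⊢
    linarith
  · linarith [(norm_nonneg _).trans (hM 0 0 (by simp))]

theorem isClosed_bend (h : IsPaperBand lam f) :
    IsClosed {p : ℝ × ℝ | IsBend f (p.1 - p.2 / 2) (p.1 + p.2 / 2)} := by
  have hc := h.continuous
  have h1 : Continuous fun p : ℝ × ℝ => f (p.1 + p.2 / 2) 1 :=
    hc.comp (f := fun p : ℝ × ℝ => (p.1 + p.2 / 2, (1 : ℝ))) (by fun_prop)
  have h0 : Continuous fun p : ℝ × ℝ => f (p.1 - p.2 / 2) 0 :=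
    hc.comp (f := fun p : ℝ × ℝ => (p.1 - p.2 / 2, (0 : ℝ))) (by fun_prop)
  exact isClosed_eq ((h1.sub h0).norm.pow 2) (by fun_prop)

theorem isClosed_midpoints (h : IsPaperBand lam f) :
    IsClosed {x : ℝ | ∃ σ, IsBend f (x - σ / 2) (x + σ / 2)} := by
  obtain ⟨K, hK⟩ := h.bend_slope_bounded
  refine IsSeqClosed.isClosed fun u x hu hx => ?_
  have hu' : ∀ n, ∃ σ, IsBend f (u n - σ / 2) (u n + σ / 2) := hu
  choose σ hσ using hu'
  obtain ⟨τ, -, φ, hφ, hτ⟩ := (isCompact_Icc (a := -K) (b := K)).tendsto_subseq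
    (x := σ) fun n => hK (u n) (σ n) (hσ n)
  have := h.isClosed_bend.mem_of_tendsto ((hx.comp hφ.tendsto_atTop).prodMk_nhds hτ)
    (Filter.Eventually.of_forall fun n => hσ (φ n))
  exact ⟨τ, this⟩

/-- Through every point of the centre line passes a bend. -/
theorem exists_bend (h : IsPaperBand lam f) (x : ℝ) :
    ∃ σ, IsBend f (x - σ / 2) (x + σ / 2) := by
  set W : Set ℝ := {z | ¬ Flat f (z, 1 / 2)} with hW
  have hhalf : ∀ z : ℝ, ((z, 1 / 2) : ℝ × ℝ) ∈ openStrip := fun z => by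
    exact ⟨by norm_num, by norm_num⟩
  have hWsub : closure W ⊆ {x : ℝ | ∃ σ, IsBend f (x - σ / 2) (x + σ / 2)} := by
    refine closure_minimal (fun z hz => ?_) h.isClosed_midpoints
    obtain ⟨a, b, hab, hz', -⟩ := h.exists_bend_of_not_flat (hhalf z) hz
    simp only at hz'
    refine ⟨b - a, ?_⟩
    convert hab using 1 <;> linarith
  obtain ⟨z₀, hz₀⟩ : ∃ z, z ∈ W := by
    by_contra! hcon
    refine h.not_straight_line (0, 1 / 2) (openStrip_le (hhalf 0)) one_ne_zero fun s => ?_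
    have := not_not.1 (hcon s) (1, 0) (1, 0)
    simpa using this
  have hshift : ∀ c : ℝ, (∀ y ∈ Set.Icc (0 : ℝ) 1, Function.Periodic (fun x => f x y) c) →
      z₀ - c ∈ W := fun c hc hfl => hz₀ (by
    simpa using flat_shift (fun y hy => (hc y hy).neg) (hhalf z₀) (p := (z₀, 1 / 2))
      (by simpa [sub_eq_add_neg] using hfl))
  by_cases hxW : x ∈ closure W
  · exact hWsub hxW
  obtain ⟨n, hn⟩ : ∃ n : ℕ, |x - z₀| ≤ n * (2 * lam) := by
    obtain ⟨n, hn⟩ := exists_nat_ge (|x - z₀| / (2 * lam))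
    exact ⟨n, (div_le_iff₀ (by linarith [h.pos])).1 hn⟩
  have hn' := abs_le.1 hn
  have hlo : z₀ - n * (2 * lam) ∈ W := hshift _ fun y hy => (h.periodic hy).nat_mul n
  have hhi : z₀ - -(n * (2 * lam)) ∈ W := hshift _ fun y hy => ((h.periodic hy).nat_mul n).neg
  set x₁ := sSup (closure W ∩ Set.Iic x) with hx₁
  set x₂ := sInf (closure W ∩ Set.Ici x) with hx₂
  have bdd₁ : BddAbove (closure W ∩ Set.Iic x) := ⟨x, fun z hz => hz.2⟩
  have bdd₂ : BddBelow (closure W ∩ Set.Ici x) := ⟨x, fun z hz => hz.2⟩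
  have mem₁ : x₁ ∈ closure W ∩ Set.Iic x :=
    (isClosed_closure.inter isClosed_Iic).csSup_mem
      ⟨_, subset_closure hlo, by simp only [Set.mem_Iic]; linarith⟩ bdd₁
  have mem₂ : x₂ ∈ closure W ∩ Set.Ici x :=
    (isClosed_closure.inter isClosed_Ici).csInf_mem
      ⟨_, subset_closure hhi, by simp only [Set.mem_Ici]; linarith⟩ bdd₂
  have lt₁ : x₁ < x := lt_of_le_of_ne mem₁.2 fun he => hxW (he ▸ mem₁.1)
  have lt₂ : x < x₂ := lt_of_le_of_ne mem₂.2 fun he => hxW (he ▸ mem₂.1)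
  obtain ⟨σ₁, hσ₁⟩ := hWsub mem₁.1
  obtain ⟨σ₂, hσ₂⟩ := hWsub mem₂.1
  obtain ⟨c, d, hcd, hx⟩ := h.bend_between (x := x) hσ₁ hσ₂ (by linarith) (by linarith) (by
    intro z hz₁ hz₂
    by_contra hz
    have hzW : z ∈ closure W := subset_closure hz
    rcases le_total z x with hle | hle
    · linarith [le_csSup bdd₁ ⟨hzW, hle⟩]
    · linarith [csInf_le bdd₂ ⟨hzW, hle⟩])
  refine ⟨d - c, ?_⟩
  convert hcd using 1 <;> linarith

theorem bend_glue (h : IsPaperBand lam f) (a b : ℝ) :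
    IsBend f (a + lam) (b + lam) ↔ IsBend f b a := by
  unfold IsBend
  have h1 := h.glue b 0 (by simp)
  have h2 := h.glue a 1 (by simp)
  simp only [sub_zero, sub_self] at h1 h2
  rw [h1, h2, norm_sub_rev, add_sub_add_right_eq_sub, ← neg_sub a b, neg_sq]

/-- A Lipschitz choice of one bend through each point of the centre line, compatible with the
glueing. -/
theorem exists_bend_selection (h : IsPaperBand lam f) :
    ∃ s : ℝ → ℝ, (∀ x, IsBend f (x - s x / 2) (x + s x / 2)) ∧ (∀ x, s (x + lam) = -s x) ∧
      ∀ x y, |s x - s y| ≤ 2 * |x - y| := by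
  obtain ⟨K, hK⟩ := h.bend_slope_bounded
  set S : ℝ → Set ℝ := fun x => {σ | IsBend f (x - σ / 2) (x + σ / 2)} with hS
  have hSne : ∀ x, (S x).Nonempty := h.exists_bend
  have hScl : ∀ x, IsClosed (S x) := fun x =>
    h.isClosed_bend.preimage (f := fun σ : ℝ => (x, σ)) (by fun_prop)
  have hSab : ∀ x, BddAbove (S x) := fun x => ⟨K, fun σ hσ => (hK x σ hσ).2⟩
  have hSbe : ∀ x, BddBelow (S x) := fun x => ⟨-K, fun σ hσ => (hK x σ hσ).1⟩
  have hsup : ∀ x, sSup (S x) ∈ S x := fun x => (hScl x).csSup_mem (hSne x) (hSab x)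
  have hinf : ∀ x, sInf (S x) ∈ S x := fun x => (hScl x).csInf_mem (hSne x) (hSbe x)
  have hrect : ∀ {x y z σ σ' τ : ℝ}, σ ∈ S x → σ' ∈ S y →
      z - τ / 2 ∈ Set.Icc (x - σ / 2) (y - σ' / 2) → z + τ / 2 ∈ Set.Icc (y + σ' / 2) (x + σ / 2) →
      τ ∈ S z := fun hσ hσ' h1 h2 => h.bend_rectangle hσ hσ' h1 h2
  have hsupL : ∀ x y, sSup (S y) - 2 * |x - y| ≤ sSup (S x) := by
    intro x y
    by_contra! hlt
    set δ := sSup (S y) - 2 * |x - y| - sSup (S x) with hδ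
    have hxy := abs_le.1 (le_refl |x - y|)
    have : sSup (S x) + δ ∈ S x := by
      refine hrect (hsup y) (hsup x) ⟨?_, ?_⟩ ⟨?_, ?_⟩ <;> linarith
    linarith [le_csSup (hSab x) this]
  have hinfL : ∀ x y, sInf (S x) ≤ sInf (S y) + 2 * |x - y| := by
    intro x y
    by_contra! hlt
    set δ := sInf (S x) - (sInf (S y) + 2 * |x - y|) with hδ
    have hxy := abs_le.1 (le_refl |x - y|)
    have : sInf (S x) - δ ∈ S x := by
      refine hrect (hinf x) (hinf y) ⟨?_, ?_⟩ ⟨?_, ?_⟩ <;> linarith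
    linarith [csInf_le (hSbe x) this]
  have hglue : ∀ x σ, -σ ∈ S (x + lam) ↔ σ ∈ S x := by
    intro x σ
    change IsBend f _ _ ↔ IsBend f _ _
    rw [← h.bend_glue (x + σ / 2) (x - σ / 2)]
    ring_nf
  have hneg : ∀ x σ, σ ∈ S (x + lam) → -σ ∈ S x := fun x σ hσ =>
    (hglue x (-σ)).1 (by rwa [neg_neg])
  refine ⟨fun x => (sInf (S x) + sSup (S x)) / 2, fun x => ?_, fun x => ?_, fun x y => ?_⟩
  · have h1 : sInf (S x) ≤ sSup (S x) := csInf_le (hSbe x) (hsup x)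
    exact hrect (hsup x) (hinf x) ⟨by linarith, by linarith⟩ ⟨by linarith, by linarith⟩
  · have e1 : sSup (S (x + lam)) = -sInf (S x) :=
      le_antisymm (le_neg.1 (csInf_le (hSbe x) (hneg x _ (hsup _))))
        (le_csSup (hSab _) ((hglue x _).2 (hinf x)))
    have e2 : sInf (S (x + lam)) = -sSup (S x) :=
      le_antisymm (csInf_le (hSbe _) ((hglue x _).2 (hsup x)))
        (neg_le.1 (le_csSup (hSab x) (hneg x _ (hinf _))))
    simp only [e1, e2]
    ring
  · have := hsupL x y
    have := hsupL y x
    have := hinfL x y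
    have := hinfL y x
    rw [abs_sub_comm y x] at *
    rw [abs_le]
    constructor <;> linarith

end IsPaperBand

theorem eq_of_continuous_of_forall_int {g : ℝ → ℝ} (hg : Continuous g)
    (hint : ∀ r, ∃ n : ℤ, g r = n) (a b : ℝ) : g a = g b := by
  choose n hn using hint
  have hgn : g = (fun k : ℤ => (k : ℝ)) ∘ n := funext hn
  have hc : Continuous n := by
    rw [Int.isClosedEmbedding_coe_real.isEmbedding.continuous_iff, ← hgn]
    exact hg
  rw [hn, hn, PreconnectedSpace.constant inferInstance hc (x := a) (y := b)]

/-- A pair of continuous functions which is twisted-periodic and positive on the diagonal in the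
first component has a common zero. -/
theorem exists_common_zero {L : ℝ} (hL : 0 < L) {G H : ℝ → ℝ → ℝ}
    (hG : Continuous fun p : ℝ × ℝ => G p.1 p.2) (hH : Continuous fun p : ℝ × ℝ => H p.1 p.2)
    (hGd : ∀ x, 0 < G x x) (hHd : ∀ x, H x x = 0)
    (hGt : ∀ x y, G y (x + L) = -G x y) (hHt : ∀ x y, H y (x + L) = -H x y) :
    ∃ x y, x ≤ y ∧ y ≤ x + L ∧ G x y = 0 ∧ H x y = 0 := by
  by_contra! hcon
  set cl : ℝ → ℝ := fun r => max 0 (min r L) with hcl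
  have hcl_cont : Continuous cl := by fun_prop
  have hcl0 : ∀ r, 0 ≤ cl r := fun r => le_max_left _ _
  have hclL : ∀ r, cl r ≤ L := fun r => max_le hL.le (min_le_right _ _)
  set X : ℝ × ℝ → ℝ := fun p => min (cl p.2) (cl p.1) with hX
  set Φ : ℝ × ℝ → ℂ := fun p =>
    ((G (X p) (cl p.2) : ℝ) : ℂ) + ((H (X p) (cl p.2) : ℝ) : ℂ) * Complex.I with hΦ
  have hXc : Continuous X := by fun_prop
  have hΦc : Continuous Φ := by
    have h1 : Continuous fun p : ℝ × ℝ => G (X p) (cl p.2) :=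
      hG.comp (f := fun p : ℝ × ℝ => (X p, cl p.2)) (by fun_prop)
    have h2 : Continuous fun p : ℝ × ℝ => H (X p) (cl p.2) :=
      hH.comp (f := fun p : ℝ × ℝ => (X p, cl p.2)) (by fun_prop)
    fun_prop
  have hΦ0 : (0 : ℂ) ∉ Φ '' Set.univ := by
    rintro ⟨p, -, hp⟩
    have hre := congrArg Complex.re hp
    have him := congrArg Complex.im hp
    simp [hΦ] at hre him
    refine hcon (X p) (cl p.2) (min_le_left _ _) ?_ hre him
    have : 0 ≤ X p := le_min (hcl0 _) (hcl0 _)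
    linarith [hclL p.2]
  have hsc : IsSimplyConnected (Set.univ : Set (ℝ × ℝ)) := by
    have : ContractibleSpace (Set.univ : Set (ℝ × ℝ)) :=
      convex_univ.contractibleSpace Set.univ_nonempty
    exact (inferInstance : SimplyConnectedSpace (Set.univ : Set (ℝ × ℝ)))
  obtain ⟨θ, hθc, hθ⟩ := Complex.exists_continuousOn_eqOn_exp_comp hsc isOpen_univ
    hΦc.continuousOn hΦ0
  rw [continuousOn_univ] at hθc
  have hexp : ∀ p, Complex.exp (θ p) = Φ p := fun p => hθ (Set.mem_univ p)
  have hdiag : ∀ r, ∃ n : ℤ, (θ (r, r)).im / (2 * Real.pi) = n := by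
    intro r
    have h1 : Φ (r, r) = (G (cl r) (cl r) : ℝ) := by simp [hΦ, hX, hHd]
    have h2 := hexp (r, r)
    rw [h1, ← Real.exp_log (hGd (cl r)), Complex.ofReal_exp, Complex.exp_eq_exp_iff_exists_int] at h2
    obtain ⟨n, hn⟩ := h2
    refine ⟨n, ?_⟩
    rw [hn, div_eq_iff (by positivity)]
    simp
  have hedge : ∀ r, ∃ n : ℤ, ((θ (r, L)).im - (θ (0, r)).im - Real.pi) / (2 * Real.pi) = n := by
    intro r
    have hL' : cl L = L := by simp [hcl, hL.le]
    have h0' : cl 0 = 0 := by simp [hcl, hL.le]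
    have h1 : Φ (r, L) = -Φ (0, r) := by
      simp only [hΦ, hX, hL', h0', min_eq_right (hclL r), min_eq_right (hcl0 r)]
      have e1 := hGt 0 (cl r)
      have e2 := hHt 0 (cl r)
      rw [zero_add] at e1 e2
      rw [e1, e2]
      push_cast
      ring
    have h2 : Complex.exp (θ (r, L)) = Complex.exp (θ (0, r) + Real.pi * Complex.I) := by
      rw [Complex.exp_add, Complex.exp_pi_mul_I, hexp, hexp, h1]
      ring
    rw [Complex.exp_eq_exp_iff_exists_int] at h2
    obtain ⟨n, hn⟩ := h2
    refine ⟨n, ?_⟩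
    rw [hn, div_eq_iff (by positivity)]
    simp
    ring
  have hdc : Continuous fun r : ℝ => (θ (r, r)).im / (2 * Real.pi) :=
    (Complex.continuous_im.comp (hθc.comp (f := fun r : ℝ => (r, r)) (by fun_prop))).div_const _
  have hec : Continuous fun r : ℝ => ((θ (r, L)).im - (θ (0, r)).im - Real.pi) / (2 * Real.pi) :=
    (((Complex.continuous_im.comp (hθc.comp (f := fun r : ℝ => (r, L)) (by fun_prop))).sub
      (Complex.continuous_im.comp (hθc.comp (f := fun r : ℝ => ((0 : ℝ), r))
        (by fun_prop)))).sub continuous_const).div_const _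
  have e1 := eq_of_continuous_of_forall_int hdc hdiag 0 L
  have e2 := eq_of_continuous_of_forall_int hec hedge 0 L
  obtain ⟨n, hn⟩ := hedge 0
  have hπ := Real.pi_pos
  rw [div_left_inj' (by positivity)] at e1 e2
  rw [div_eq_iff (by positivity)] at hn
  have h3 : (2 * (n : ℝ) + 1) * (2 * Real.pi) = 0 := by linarith
  rcases mul_eq_zero.1 h3 with h4 | h4
  · have : (2 * n + 1 : ℤ) = 0 := by exact_mod_cast h4
    omega
  · linarith

/-- The determinant of three vectors of `ℝ³`. -/
def triple (a b c : E3) : ℝ :=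
  a 0 * (b 1 * c 2 - b 2 * c 1) + a 1 * (b 2 * c 0 - b 0 * c 2) + a 2 * (b 0 * c 1 - b 1 * c 0)

theorem triple_sq_of_orthogonal {a b c : E3} (hab : inner ℝ a b = (0 : ℝ))
    (hac : inner ℝ a c = (0 : ℝ)) (hbc : inner ℝ b c = (0 : ℝ)) :
    triple a b c ^ 2 = ‖a‖ ^ 2 * ‖b‖ ^ 2 * ‖c‖ ^ 2 := by
  have key : triple a b c ^ 2 = inner ℝ a a * inner ℝ b b * inner ℝ c c
      + 2 * inner ℝ a b * inner ℝ a c * inner ℝ b c - inner ℝ a a * inner ℝ b c ^ 2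
      - inner ℝ b b * inner ℝ a c ^ 2 - inner ℝ c c * inner ℝ a b ^ 2 := by
    simp only [inner_eq_coords, triple]
    ring
  rw [key, hab, hac, hbc]
  simp only [real_inner_self_eq_norm_sq]
  ring

theorem triple_sub_smul_sub_smul (a b c : E3) (α β : ℝ) :
    triple (a - α • b - β • c) b c = triple a b c := by
  simp only [triple, PiLp.sub_apply, PiLp.smul_apply, smul_eq_mul]
  ring

/-- A vector which is linearly dependent on two nonzero orthogonal vectors lies in their span. -/
theorem exists_combo_of_triple_eq_zero {z u v : E3} (hu : u ≠ 0) (hv : v ≠ 0)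
    (huv : inner ℝ u v = (0 : ℝ)) (hz : triple z u v = 0) : ∃ α β : ℝ, z = α • u + β • v := by
  have hu' : ‖u‖ ^ 2 ≠ 0 := pow_ne_zero 2 (norm_ne_zero_iff.2 hu)
  have hv' : ‖v‖ ^ 2 ≠ 0 := pow_ne_zero 2 (norm_ne_zero_iff.2 hv)
  refine ⟨inner ℝ z u / ‖u‖ ^ 2, inner ℝ z v / ‖v‖ ^ 2, ?_⟩
  set α := inner ℝ z u / ‖u‖ ^ 2 with hα
  set β := inner ℝ z v / ‖v‖ ^ 2 with hβ
  set w := z - α • u - β • v with hw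
  have hwu : inner ℝ w u = (0 : ℝ) := by
    rw [hw, inner_sub_left, inner_sub_left, real_inner_smul_left, real_inner_smul_left,
      real_inner_self_eq_norm_sq, real_inner_comm u v, huv, hα, div_mul_cancel₀ _ hu']
    ring
  have hwv : inner ℝ w v = (0 : ℝ) := by
    rw [hw, inner_sub_left, inner_sub_left, real_inner_smul_left, real_inner_smul_left,
      real_inner_self_eq_norm_sq, huv, hβ, div_mul_cancel₀ _ hv']
    ring
  have h1 := triple_sq_of_orthogonal hwu hwv huv
  rw [triple_sub_smul_sub_smul, hz] at h1
  have h2 : ‖w‖ ^ 2 = 0 := by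
    have h3 : ‖w‖ ^ 2 * (‖u‖ ^ 2 * ‖v‖ ^ 2) = 0 := by linarith
    exact (mul_eq_zero.1 h3).resolve_right (mul_ne_zero hu' hv')
  have h4 : w = 0 := norm_eq_zero.1 (pow_eq_zero_iff two_ne_zero |>.1 h2)
  rw [hw] at h4
  rw [← sub_eq_zero, ← h4]
  abel

/-- A choice of one bend through each point of the centre line. -/
structure IsBendSelection (lam : ℝ) (f : ℝ → ℝ → E3) (s : ℝ → ℝ) : Prop where
  bend : ∀ x, IsBend f (x - s x / 2) (x + s x / 2)
  glue : ∀ x, s (x + lam) = -s x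
  lipschitz : ∀ x y, |s x - s y| ≤ 2 * |x - y|

/-- The bend vector through `x`. -/
noncomputable def bendVec (f : ℝ → ℝ → E3) (s : ℝ → ℝ) (x : ℝ) : E3 :=
  f (x + s x / 2) 1 - f (x - s x / 2) 0

/-- The midpoint of the bend through `x`. -/
noncomputable def bendMid (f : ℝ → ℝ → E3) (s : ℝ → ℝ) (x : ℝ) : E3 :=
  f (x - s x / 2) 0 + (1 / 2 : ℝ) • bendVec f s x

/-- A pair of bends that span perpendicular coplanar lines. -/
structure IsPerpPair (lam : ℝ) (f : ℝ → ℝ → E3) (s : ℝ → ℝ) (x y α β : ℝ) : Prop where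
  lt : x < y
  lt_add : y < x + lam
  inner_eq : inner ℝ (bendVec f s x) (bendVec f s y) = (0 : ℝ)
  mid_sub : bendMid f s x - bendMid f s y = α • bendVec f s x + β • bendVec f s y

namespace IsPaperBand

variable {lam : ℝ} {f : ℝ → ℝ → E3} {s : ℝ → ℝ}

theorem bendVec_add (h : IsPaperBand lam f) (hs : IsBendSelection lam f s) (x : ℝ) :
    bendVec f s (x + lam) = -bendVec f s x := by
  have h1 := h.glue (x - s x / 2) 0 (by simp)
  have h2 := h.glue (x + s x / 2) 1 (by simp)
  simp only [sub_zero, sub_self] at h1 h2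
  rw [bendVec, bendVec, hs.glue, ← h1, ← h2]
  ring_nf
  abel

theorem bendMid_add (h : IsPaperBand lam f) (hs : IsBendSelection lam f s) (x : ℝ) :
    bendMid f s (x + lam) = bendMid f s x := by
  have h2 := h.glue (x + s x / 2) 1 (by simp)
  simp only [sub_self] at h2
  rw [bendMid, bendMid, h.bendVec_add hs, hs.glue,
    show x + lam - -s x / 2 = x + s x / 2 + lam by ring, h2, bendVec]
  module

theorem norm_bendVec_sq (hs : IsBendSelection lam f s) (x : ℝ) :
    ‖bendVec f s x‖ ^ 2 = 1 + s x ^ 2 := by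
  have := hs.bend x
  unfold IsBend at this
  rw [bendVec, this]
  ring

theorem bendVec_ne_zero (hs : IsBendSelection lam f s) (x : ℝ) : bendVec f s x ≠ 0 := by
  intro h0
  have := norm_bendVec_sq hs x
  rw [h0, norm_zero] at this
  nlinarith [sq_nonneg (s x)]

theorem exists_perpPair (h : IsPaperBand lam f) (hs : IsBendSelection lam f s) :
    ∃ x y α β, IsPerpPair lam f s x y α β := by
  have hsc : Continuous s := by
    have : LipschitzWith 2 s := LipschitzWith.of_dist_le_mul fun x y => by
      simpa [Real.dist_eq] using hs.lipschitz x y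
    exact this.continuous
  have hP : Continuous fun x => f (x - s x / 2) 0 :=
    h.continuous.comp (f := fun x : ℝ => (x - s x / 2, (0 : ℝ))) (by fun_prop)
  have hQ : Continuous fun x => f (x + s x / 2) 1 :=
    h.continuous.comp (f := fun x : ℝ => (x + s x / 2, (1 : ℝ))) (by fun_prop)
  have hU : Continuous (bendVec f s) := hQ.sub hP
  have hm : Continuous (bendMid f s) := hP.add (by fun_prop)
  have hUU : ∀ x, 0 < (inner ℝ (bendVec f s x) (bendVec f s x) : ℝ) := fun x => by
    rw [real_inner_self_eq_norm_sq, norm_bendVec_sq hs]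
    positivity
  obtain ⟨x, y, hxy, hyx, hG, hH⟩ := exists_common_zero h.pos
    (G := fun x y => inner ℝ (bendVec f s x) (bendVec f s y))
    (H := fun x y => triple (bendMid f s x - bendMid f s y) (bendVec f s x) (bendVec f s y))
    (by fun_prop) (by unfold triple; fun_prop) hUU (by simp [triple])
    (fun x y => by rw [h.bendVec_add hs, inner_neg_right, real_inner_comm])
    (fun x y => by
      rw [h.bendVec_add hs, h.bendMid_add hs]
      simp only [triple, PiLp.sub_apply, PiLp.neg_apply]
      ring)
  obtain ⟨α, β, hαβ⟩ := exists_combo_of_triple_eq_zero (bendVec_ne_zero hs x)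
    (bendVec_ne_zero hs y) hG hH
  refine ⟨x, y, α, β, lt_of_le_of_ne hxy ?_, lt_of_le_of_ne hyx ?_, hG, hαβ⟩
  · rintro rfl
    exact (hUU x).ne' hG
  · rintro rfl
    simp only [h.bendVec_add hs, inner_neg_right, neg_eq_zero] at hG
    exact (hUU x).ne' hG

theorem perpPair_rotate (h : IsPaperBand lam f) (hs : IsBendSelection lam f s) {x y α β : ℝ}
    (hp : IsPerpPair lam f s x y α β) : IsPerpPair lam f s y (x + lam) (-β) α := by
  refine ⟨hp.lt_add, by linarith [hp.lt], ?_, ?_⟩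
  · rw [h.bendVec_add hs, inner_neg_right, real_inner_comm, hp.inner_eq, neg_zero]
  · rw [h.bendVec_add hs, h.bendMid_add hs, ← neg_sub, hp.mid_sub]
    module

theorem deck (h : IsPaperBand lam f) (hs : IsBendSelection lam f s) (n : ℤ) :
    ∃ e : ℝ, (e = 1 ∨ e = -1) ∧
      (∀ X ρ, |ρ| ≤ 1 / 2 → f (X + n * lam) (1 / 2 + e * ρ) = f X (1 / 2 + ρ)) ∧
      ∀ x, s (x + n * lam) = e * s x := by
  have hstep : ∀ X ρ, |ρ| ≤ 1 / 2 → f (X + lam) (1 / 2 + -ρ) = f X (1 / 2 + ρ) := by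
    intro X ρ hρ
    have := abs_le.1 hρ
    have := h.glue X (1 / 2 + ρ) ⟨by linarith, by linarith⟩
    rw [← this]
    ring_nf
  induction n using Int.induction_on with
  | zero => exact ⟨1, by simp⟩
  | succ n ih =>
    obtain ⟨e, he, h1, h2⟩ := ih
    have hea : |e| = 1 := by rcases he with rfl | rfl <;> simp
    refine ⟨-e, by rcases he with rfl | rfl <;> simp, fun X ρ hρ => ?_, fun x => ?_⟩
    · have := hstep (X + n * lam) (e * ρ) (by rw [abs_mul, hea, one_mul]; exact hρ)
      push_cast at h1 ⊢
      rw [← h1 X ρ hρ, ← this]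
      ring_nf
    · push_cast at h2 ⊢
      rw [show x + (n + 1) * lam = x + n * lam + lam by ring, hs.glue, h2]
      ring
  | pred n ih =>
    obtain ⟨e, he, h1, h2⟩ := ih
    have hea : |e| = 1 := by rcases he with rfl | rfl <;> simp
    refine ⟨-e, by rcases he with rfl | rfl <;> simp, fun X ρ hρ => ?_, fun x => ?_⟩
    · have := hstep (X + (-n - 1) * lam) (-e * ρ) (by rw [abs_mul, abs_neg, hea, one_mul]; exact hρ)
      push_cast at h1 ⊢
      rw [← h1 X ρ hρ, ← this]
      ring_nf
    · push_cast at h2 ⊢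
      have := hs.glue (x + (-n - 1) * lam)
      rw [show x + (-n - 1) * lam + lam = x + -n * lam by ring, h2] at this
      linarith

theorem not_perpPair_short (h : IsPaperBand lam f) (hs : IsBendSelection lam f s)
    (hinj : ∀ x x' y y' : ℝ, x ∈ Set.Ico (0 : ℝ) lam → x' ∈ Set.Ico (0 : ℝ) lam →
      y ∈ Set.Icc (0 : ℝ) 1 → y' ∈ Set.Icc (0 : ℝ) 1 → f x y = f x' y' → x = x' ∧ y = y')
    {x y α β : ℝ} (hp : IsPerpPair lam f s x y α β) : 1 / 2 ≤ |α| ∨ 1 / 2 ≤ |β| := by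
  by_contra! hcon
  have hpt : ∀ z ρ, |ρ| ≤ 1 / 2 → f (z + ρ * s z) (1 / 2 + ρ) = bendMid f s z + ρ • bendVec f s z := by
    intro z ρ hρ
    have := abs_le.1 hρ
    have := h.bend_point (hs.bend z) (r := 1 / 2 + ρ) ⟨by linarith, by linarith⟩
    rw [show z + ρ * s z = z - s z / 2 + (1 / 2 + ρ) * (z + s z / 2 - (z - s z / 2)) by ring, this,
      bendMid, bendVec]
    module
  have hα : |-α| ≤ 1 / 2 := by rw [abs_neg]; exact hcon.1.le
  have hmeet : f (x + -α * s x) (1 / 2 + -α) = f (y + β * s y) (1 / 2 + β) := by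
    rw [hpt _ _ hα, hpt _ _ hcon.2.le, ← sub_eq_zero]
    have := hp.mid_sub
    rw [← sub_eq_zero] at this
    rw [← this]
    module
  have hred : ∀ z ρ, |ρ| ≤ 1 / 2 → ∃ (n : ℤ) (e : ℝ),
      (e = 1 ∨ e = -1) ∧ (∀ w, s (w + n * lam) = e * s w) ∧
      z + n * lam ∈ Set.Ico (0 : ℝ) lam ∧ 1 / 2 + e * ρ ∈ Set.Icc (0 : ℝ) 1 ∧
      f (z + n * lam) (1 / 2 + e * ρ) = f z (1 / 2 + ρ) := by
    intro z ρ hρ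
    obtain ⟨n, hn, -⟩ := existsUnique_add_zsmul_mem_Ico h.pos z 0
    simp only [zsmul_eq_mul, zero_add] at hn
    obtain ⟨e, he, h1, h2⟩ := h.deck hs n
    have := abs_le.1 hρ
    refine ⟨n, e, he, h2, hn, ?_, h1 z ρ hρ⟩
    rcases he with rfl | rfl <;> constructor <;> linarith
  obtain ⟨n, e, he, hse, hn, hr, hf⟩ := hred _ _ hα
  obtain ⟨n', e', he', hse', hn', hr', hf'⟩ := hred _ _ hcon.2.le
  obtain ⟨hX, hY⟩ := hinj _ _ _ _ hn hn' hr hr' (by rw [hf, hf', hmeet])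
  have hee : e ^ 2 = 1 := by rcases he with rfl | rfl <;> norm_num
  have hee' : e' ^ 2 = 1 := by rcases he' with rfl | rfl <;> norm_num
  have hβ : β = e' * e * -α := by linear_combination -e' * hY - β * hee'
  set x' := x + ((n - n' : ℤ) : ℝ) * lam with hx'
  have hsx : s x' = e' * e * s x := by
    have h1 := hse' x'
    rw [show x' + n' * lam = x + n * lam by rw [hx']; push_cast; ring, hse] at h1
    linear_combination -e' * h1 - s x' * hee'
  have hyx : y - x' = β * (s x' - s y) := by
    have h1 : β * s x' = -α * s x := by
      rw [hβ, hsx]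
      linear_combination -α * s x * (e ^ 2 * hee' + hee)
    rw [hx', Int.cast_sub] at *
    linear_combination -hX - h1
  have hzero : y = x' := by
    have h1 := hs.lipschitz x' y
    have h2 : |y - x'| = |β| * |s x' - s y| := by rw [hyx, abs_mul]
    have h3 : |y - x'| ≤ |β| * (2 * |y - x'|) := by
      rw [abs_sub_comm x' y] at h1
      exact h2.le.trans (mul_le_mul_of_nonneg_left h1 (abs_nonneg _))
    have h4 : |y - x'| = 0 := by nlinarith [abs_nonneg (y - x'), hcon.2]
    exact sub_eq_zero.1 (abs_eq_zero.1 h4)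
  have h1 := hp.lt
  have h2 := hp.lt_add
  rw [hzero, hx'] at h1 h2
  have h3 : (0 : ℝ) < ((n - n' : ℤ) : ℝ) := by
    by_contra! hle
    linarith [mul_nonpos_of_nonpos_of_nonneg hle h.pos.le]
  have h4 : ((n - n' : ℤ) : ℝ) < 1 := by
    by_contra! hle
    linarith [mul_le_mul_of_nonneg_right hle h.pos.le]
  have h5 : 0 < n - n' := by exact_mod_cast h3
  have h6 : n - n' < 1 := by exact_mod_cast h4
  omega

theorem exists_long_perpPair (h : IsPaperBand lam f) (hs : IsBendSelection lam f s)
    (hinj : ∀ x x' y y' : ℝ, x ∈ Set.Ico (0 : ℝ) lam → x' ∈ Set.Ico (0 : ℝ) lam →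
      y ∈ Set.Icc (0 : ℝ) 1 → y' ∈ Set.Icc (0 : ℝ) 1 → f x y = f x' y' → x = x' ∧ y = y') :
    ∃ x y α β, IsPerpPair lam f s x y α β ∧ 1 / 2 ≤ β := by
  obtain ⟨x, y, α, β, h0⟩ := h.exists_perpPair hs
  have h1 := h.perpPair_rotate hs h0
  have h2 := h.perpPair_rotate hs h1
  have h3 := h.perpPair_rotate hs h2
  rcases h.not_perpPair_short hs hinj h0 with hα | hβ
  · rcases le_abs.1 hα with hα | hα
    · exact ⟨_, _, _, _, h1, hα⟩
    · exact ⟨_, _, _, _, h3, hα⟩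
  · rcases le_abs.1 hβ with hβ | hβ
    · exact ⟨_, _, _, _, h0, hβ⟩
    · exact ⟨_, _, _, _, h2, hβ⟩

/-- The T-pattern: a bend `XZ`, centred at `m` and directed by `u`, together with a boundary point
at height at least `1` over the line `XZ`. -/
theorem exists_T_pattern (h : IsPaperBand lam f)
    (hinj : ∀ x x' y y' : ℝ, x ∈ Set.Ico (0 : ℝ) lam → x' ∈ Set.Ico (0 : ℝ) lam →
      y ∈ Set.Icc (0 : ℝ) 1 → y' ∈ Set.Icc (0 : ℝ) 1 → f x y = f x' y' → x = x' ∧ y = y') :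
    ∃ (t b τ T p k : ℝ) (m u v : E3), 0 ≤ T ∧ T ^ 2 = 1 + τ ^ 2 ∧ 1 ≤ k ∧ t ≤ b ∧
      b ≤ t + lam + τ ∧ ‖u‖ = 1 ∧ ‖v‖ = 1 ∧ inner ℝ u v = (0 : ℝ) ∧
      f t 0 = m - (T / 2) • u ∧ f (t + lam + τ) 0 = m + (T / 2) • u ∧
      f b 0 = m + p • u + k • v := by
  obtain ⟨s, hs1, hs2, hs3⟩ := h.exists_bend_selection
  have hs : IsBendSelection lam f s := ⟨hs1, hs2, hs3⟩
  obtain ⟨x, y, α, β, hp, hβ⟩ := h.exists_long_perpPair hs hinj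
  have hx := norm_bendVec_sq hs x
  have hy := norm_bendVec_sq hs y
  have hx0 := norm_ne_zero_iff.2 (bendVec_ne_zero hs x)
  have hy0 := norm_ne_zero_iff.2 (bendVec_ne_zero hs y)
  have hy1 : 1 ≤ ‖bendVec f s y‖ := by
    rw [← one_le_sq_iff₀ (norm_nonneg _), hy]
    linarith [sq_nonneg (s y)]
  have hlip := abs_le.1 (hs.lipschitz y x)
  have hlip' := abs_le.1 (hs.lipschitz y (x + lam))
  rw [abs_of_pos (sub_pos.2 hp.lt)] at hlip
  rw [abs_of_neg (sub_neg.2 hp.lt_add), hs.glue] at hlip'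
  set U := bendVec f s x
  set V := bendVec f s y
  have hU : ‖U‖ • ‖U‖⁻¹ • U = U := smul_inv_smul₀ hx0 U
  have hV : ‖V‖ • ‖V‖⁻¹ • V = V := smul_inv_smul₀ hy0 V
  refine ⟨x - s x / 2, y - s y / 2, s x, ‖U‖, -α * ‖U‖, (β + 1 / 2) * ‖V‖, bendMid f s x,
    ‖U‖⁻¹ • U, -(‖V‖⁻¹ • V), norm_nonneg _, hx, by nlinarith, by linarith, by linarith,
    ?_, ?_, ?_, ?_, ?_, ?_⟩
  · rw [norm_smul, norm_inv, norm_norm, inv_mul_cancel₀ hx0]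
  · rw [norm_neg, norm_smul, norm_inv, norm_norm, inv_mul_cancel₀ hy0]
  · rw [inner_neg_right, real_inner_smul_left, real_inner_smul_right, hp.inner_eq]
    simp
  · rw [div_eq_inv_mul ‖U‖ 2, mul_smul, hU, bendMid]
    module
  · have h2 := h.glue (x + s x / 2) 1 (by simp)
    rw [sub_self] at h2
    rw [show x - s x / 2 + lam + s x = x + s x / 2 + lam by ring, h2, div_eq_inv_mul ‖U‖ 2, mul_smul, hU,
      bendMid]
    change _ = _ + (1 / 2 : ℝ) • (f (x + s x / 2) 1 - f (x - s x / 2) 0) +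
      (2⁻¹ : ℝ) • (f (x + s x / 2) 1 - f (x - s x / 2) 0)
    module
  · rw [mul_smul, hU, smul_neg, mul_smul, hV]
    have h1 := hp.mid_sub
    rw [sub_eq_iff_eq_add] at h1
    rw [h1, bendMid]
    change _ = _ + (f _ _ + (1 / 2 : ℝ) • V) + _ + _
    module

end IsPaperBand

/-- The defects of a triangle with base `T`, height `k` and edges dominated by `l₁`, `l₂`, in terms of the
defect `(l₁ + l₂) ^ 2 - T ^ 2 - 4 * k ^ 2` of the isosceles triangle of the same perimeter. -/
theorem triangle_defect_bounds {T p k l₁ l₂ : ℝ} (hk : 1 ≤ k) (hl₁ : 0 ≤ l₁) (hl₂ : 0 ≤ l₂)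
    (h₁ : (p + T / 2) ^ 2 + k ^ 2 ≤ l₁ ^ 2) (h₂ : (p - T / 2) ^ 2 + k ^ 2 ≤ l₂ ^ 2) :
    0 ≤ (l₁ + l₂) ^ 2 - T ^ 2 - 4 * k ^ 2 ∧
      l₁ ^ 2 - ((p + T / 2) ^ 2 + k ^ 2) ≤ (l₁ + l₂) ^ 2 - T ^ 2 - 4 * k ^ 2 ∧
      l₂ ^ 2 - ((p - T / 2) ^ 2 + k ^ 2) ≤ (l₁ + l₂) ^ 2 - T ^ 2 - 4 * k ^ 2 ∧
      p ^ 2 ≤ ((l₁ + l₂) ^ 2 - T ^ 2 - 4 * k ^ 2) * (1 / 2 + T ^ 2 / 8) := by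
  have hkk : 1 ≤ k ^ 2 := one_le_pow₀ hk
  have hl₁' : 0 < l₁ := lt_of_le_of_ne hl₁ fun he => by
    rw [← he] at h₁
    linarith [sq_nonneg (p + T / 2)]
  have hl₂' : 0 < l₂ := lt_of_le_of_ne hl₂ fun he => by
    rw [← he] at h₂
    linarith [sq_nonneg (p - T / 2)]
  have hL : 0 < l₁ + l₂ := add_pos hl₁' hl₂'
  obtain ⟨w, hw⟩ : ∃ w, w = l₁ / (l₁ + l₂) := ⟨_, rfl⟩
  have hw1 : l₁ = w * (l₁ + l₂) := by rw [hw, div_mul_cancel₀ _ hL.ne']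
  have hw2 : l₂ = (1 - w) * (l₁ + l₂) := by linarith
  have hw0 : 0 < w := hw ▸ div_pos hl₁' hL
  have hw0' : 0 < 1 - w := pos_of_mul_pos_left (hw2 ▸ hl₂') hL.le
  obtain ⟨D, hD⟩ : ∃ D, D = (l₁ + l₂) ^ 2 - T ^ 2 - 4 * k ^ 2 := ⟨_, rfl⟩
  obtain ⟨E₁, hE₁⟩ : ∃ E₁, E₁ = l₁ ^ 2 - ((p + T / 2) ^ 2 + k ^ 2) := ⟨_, rfl⟩
  obtain ⟨E₂, hE₂⟩ : ∃ E₂, E₂ = l₂ ^ 2 - ((p - T / 2) ^ 2 + k ^ 2) := ⟨_, rfl⟩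
  have hE₁0 : 0 ≤ E₁ := by linarith
  have hE₂0 : 0 ≤ E₂ := by linarith
  rw [← hD, ← hE₁, ← hE₂]
  have key : (1 - w) * E₁ + w * E₂ + (p - (w - 1 / 2) * T) ^ 2 + k ^ 2 * (1 - 2 * w) ^ 2
      = w * (1 - w) * D := by
    have hs₁ : l₁ ^ 2 = w ^ 2 * (l₁ + l₂) ^ 2 := by rw [← mul_pow, ← hw1]
    have hs₂ : l₂ ^ 2 = (1 - w) ^ 2 * (l₁ + l₂) ^ 2 := by rw [← mul_pow, ← hw2]
    rw [hE₁, hE₂, hD, hs₁, hs₂]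
    ring
  have n1 := mul_nonneg hw0'.le hE₁0
  have n2 := mul_nonneg hw0.le hE₂0
  have n3 := sq_nonneg (p - (w - 1 / 2) * T)
  have n5 := sq_nonneg (1 - 2 * w)
  have n4 : (1 - 2 * w) ^ 2 ≤ k ^ 2 * (1 - 2 * w) ^ 2 := le_mul_of_one_le_left n5 hkk
  have hww : 0 < w * (1 - w) := mul_pos hw0 hw0'
  have hww' : w * (1 - w) ≤ 1 / 4 := by linarith [sq_nonneg (w - 1 / 2)]
  have hD0 : 0 ≤ D := nonneg_of_mul_nonneg_right (by linarith) hww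
  have hwD : w * (1 - w) * D ≤ 1 / 4 * D := mul_le_mul_of_nonneg_right hww' hD0
  refine ⟨hD0, ?_, ?_, ?_⟩
  · have : E₁ ≤ w * D := le_of_mul_le_mul_left (by linarith) hw0'
    linarith [mul_nonneg hw0'.le hD0]
  · have : E₂ ≤ (1 - w) * D := le_of_mul_le_mul_left (by linarith) hw0
    linarith [mul_nonneg hw0.le hD0]
  · have h5 : (1 - 2 * w) ^ 2 * T ^ 2 ≤ 1 / 4 * D * T ^ 2 :=
      mul_le_mul_of_nonneg_right (by linarith) (sq_nonneg T)
    linarith [sq_nonneg (p - 2 * ((w - 1 / 2) * T))]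

/-- Size bounds for a T-pattern of small aspect ratio whose two defects are nonnegative. -/
theorem T_pattern_size_bounds {ε lam τ T k : ℝ} (hε0 : 0 < ε) (hε : ε < 1 / 4) (hlam : 0 < lam)
    (hratio : lam < Real.sqrt 3 + ε) (hT0 : 0 ≤ T) (hT : T ^ 2 = 1 + τ ^ 2) (hk : 1 ≤ k)
    (hD : 0 ≤ (lam + τ) ^ 2 - T ^ 2 - 4 * k ^ 2) (h₃ : T ^ 2 ≤ (lam - τ) ^ 2) :
    (lam + τ) ^ 2 - T ^ 2 - 4 * k ^ 2 ≤ 8 * ε ∧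
      (lam - τ) ^ 2 - T ^ 2 ≤ 8 * ε ∧ τ < lam ∧ |T - 2 * Real.sqrt 3 / 3| ≤ ε ∧
      T ^ 2 ≤ 11 / 6 ∧ k - 1 ≤ ε := by
  have hs3 : Real.sqrt 3 ^ 2 = 3 := Real.sq_sqrt (by norm_num)
  have hs1 : Real.sqrt 3 ≤ 7 / 4 := by
    rw [Real.sqrt_le_left (by norm_num)]
    norm_num
  have hs2 : 3 / 2 ≤ Real.sqrt 3 := Real.le_sqrt_of_sq_le (by norm_num)
  have hlam2 : lam ^ 2 ≤ 3 + 4 * ε := by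
    have h1 : lam ^ 2 ≤ (Real.sqrt 3 + ε) ^ 2 := pow_le_pow_left₀ hlam.le hratio.le 2
    have h2 := mul_le_mul_of_nonneg_right hs1 hε0.le
    have h3 := mul_le_mul_of_nonneg_right hε.le hε0.le
    linarith
  have hkk : 2 * (k - 1) ≤ k ^ 2 - 1 := by linarith [sq_nonneg (k - 1)]
  have hD3 : 0 ≤ lam ^ 2 - 2 * (lam * τ) - 1 := by linarith
  have hlam3 : 3 ≤ lam ^ 2 := by linarith
  have hlt1 : lam * τ ≤ 1 + 2 * ε := by linarith
  have hlt2 : 1 - 2 * ε ≤ lam * τ := by linarith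
  have ht1 : τ ^ 2 ≤ 1 / 3 + 2 * ε := by
    have h1 : (lam * τ) ^ 2 ≤ (1 + 2 * ε) ^ 2 := pow_le_pow_left₀ (by linarith) hlt1 2
    have h2 : 3 * τ ^ 2 ≤ lam ^ 2 * τ ^ 2 := mul_le_mul_of_nonneg_right hlam3 (sq_nonneg τ)
    rw [mul_pow] at h1
    have h3 := mul_le_mul_of_nonneg_right hε.le hε0.le
    linarith
  have ht2 : 1 / 3 - 2 * ε ≤ τ ^ 2 := by
    by_contra! hlt
    have h1 : (1 - 2 * ε) ^ 2 ≤ (lam * τ) ^ 2 := pow_le_pow_left₀ (by linarith) hlt2 2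
    have h2 : lam ^ 2 * τ ^ 2 ≤ (3 + 4 * ε) * τ ^ 2 := mul_le_mul_of_nonneg_right hlam2 (sq_nonneg τ)
    have h3 : (3 + 4 * ε) * τ ^ 2 < (3 + 4 * ε) * (1 / 3 - 2 * ε) :=
      mul_lt_mul_of_pos_left hlt (by linarith)
    rw [mul_pow] at h1
    linarith [sq_nonneg ε]
  have hT1 : 1 ≤ T := by
    refine (one_le_sq_iff₀ hT0).1 ?_
    linarith [sq_nonneg τ]
  have hTc : (T - 2 * Real.sqrt 3 / 3) * (T + 2 * Real.sqrt 3 / 3) = τ ^ 2 - 1 / 3 := by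
    linear_combination hT - (4 / 9) * hs3
  refine ⟨by linarith, by linarith, ?_, ?_, by linarith, by linarith⟩
  · refine lt_of_mul_lt_mul_left ?_ hlam.le
    linarith [sq_nonneg lam]
  · have hpos : 2 ≤ T + 2 * Real.sqrt 3 / 3 := by linarith
    have h1 : |T - 2 * Real.sqrt 3 / 3| * (T + 2 * Real.sqrt 3 / 3) ≤ 2 * ε := by
      rw [← abs_of_pos (show 0 < T + 2 * Real.sqrt 3 / 3 by linarith), ← abs_mul, hTc, abs_le]
      constructor <;> linarith
    have h2 := mul_le_mul_of_nonneg_left hpos (abs_nonneg (T - 2 * Real.sqrt 3 / 3))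
    linarith

/-- A 1-Lipschitz arc whose chord is almost as long as the arc stays close to the chord, hence to any
segment with nearby endpoints. -/
theorem norm_segment_sub_arc_lt {ε : ℝ} (hε0 : 0 < ε) {W : Type*} [NormedAddCommGroup W]
    [InnerProductSpace ℝ W] {g : ℝ → W} (hg : ∀ x x', ‖g x' - g x‖ ^ 2 ≤ (x' - x) ^ 2)
    {t t' : ℝ} (harc : (t' - t) ^ 2 - ‖g t' - g t‖ ^ 2 ≤ 8 * ε) {A B : W}
    (hA : ‖A - g t‖ ≤ 3 * Real.sqrt ε) (hB : ‖B - g t'‖ ≤ 3 * Real.sqrt ε) {r : ℝ}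
    (hr : r ∈ Set.Icc (0 : ℝ) 1) :
    ‖A + r • (B - A) - g (t + r * (t' - t))‖ < 6 * Real.sqrt ε := by
  have hρ : 0 < Real.sqrt ε := Real.sqrt_pos.2 hε0
  have hρ2 : Real.sqrt ε ^ 2 = ε := Real.sq_sqrt hε0.le
  have h1 := norm_sub_combo_sq (g (t + r * (t' - t))) (g t) (g t') r
  have h2 := hg t (t + r * (t' - t))
  have h3 := hg t' (t + r * (t' - t))
  have hr' := sub_nonneg.2 hr.2
  have h4 : ‖g (t + r * (t' - t)) - (g t + r • (g t' - g t))‖ ^ 2 ≤ (3 / 2 * Real.sqrt ε) ^ 2 := by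
    rw [h1, mul_pow, hρ2]
    have h5 := mul_le_mul_of_nonneg_left h2 hr'
    have h6 := mul_le_mul_of_nonneg_left h3 hr.1
    have h7 := mul_le_mul_of_nonneg_left harc (mul_nonneg hr.1 hr')
    nlinarith [sq_nonneg (r - 1 / 2)]
  have h5 := abs_le_of_sq_le_sq' h4 (by positivity)
  have h6 : A + r • (B - A) - g (t + r * (t' - t)) = ((1 - r) • (A - g t) + r • (B - g t'))
      - (g (t + r * (t' - t)) - (g t + r • (g t' - g t))) := by module
  have h7 : ‖(1 - r) • (A - g t) + r • (B - g t')‖ ≤ 3 * Real.sqrt ε := by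
    refine (norm_add_le _ _).trans ?_
    rw [norm_smul, norm_smul, Real.norm_of_nonneg hr', Real.norm_of_nonneg hr.1]
    nlinarith [mul_le_mul_of_nonneg_left hA hr', mul_le_mul_of_nonneg_left hB hr.1]
  rw [h6]
  refine (norm_sub_le _ _).trans_lt ?_
  linarith [h5.2]

theorem norm_combo_sq {W : Type*} [NormedAddCommGroup W] [InnerProductSpace ℝ W] {u v : W}
    (hu : ‖u‖ = 1) (hv : ‖v‖ = 1) (huv : inner ℝ u v = (0 : ℝ)) (a b : ℝ) :
    ‖a • u + b • v‖ ^ 2 = a ^ 2 + b ^ 2 := by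
  rw [norm_add_sq_real, norm_smul, norm_smul, real_inner_smul_left, real_inner_smul_right, huv, hu,
    hv, Real.norm_eq_abs, Real.norm_eq_abs]
  simp

/-- The boundary of an almost optimal band splits into three arcs, each of which follows an edge of
an equilateral triangle. -/
theorem IsPaperBand.exists_triangle {lam ε : ℝ} {f : ℝ → ℝ → E3} (h : IsPaperBand lam f)
    (hinj : ∀ x x' y y' : ℝ, x ∈ Set.Ico (0 : ℝ) lam → x' ∈ Set.Ico (0 : ℝ) lam →
      y ∈ Set.Icc (0 : ℝ) 1 → y' ∈ Set.Icc (0 : ℝ) 1 → f x y = f x' y' → x = x' ∧ y = y')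
    (hε0 : 0 < ε) (hε : ε < 1 / 4) (hratio : lam < Real.sqrt 3 + ε) :
    ∃ (A B C : E3) (t₀ t₁ t₂ : ℝ), dist A B = 2 * Real.sqrt 3 / 3 ∧
      dist B C = 2 * Real.sqrt 3 / 3 ∧ dist C A = 2 * Real.sqrt 3 / 3 ∧
      t₀ < t₁ ∧ t₁ < t₂ ∧ t₂ < t₀ + 2 * lam ∧ ∀ r ∈ Set.Icc (0 : ℝ) 1,
        ‖A + r • (B - A) - f (t₀ + r * (t₁ - t₀)) 0‖ < 6 * Real.sqrt ε ∧
        ‖B + r • (C - B) - f (t₁ + r * (t₂ - t₁)) 0‖ < 6 * Real.sqrt ε ∧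
        ‖C + r • (A - C) - f (t₂ + r * (t₀ + 2 * lam - t₂)) 0‖ < 6 * Real.sqrt ε := by
  obtain ⟨t, b, τ, T, p, k, m, u, v, hT0, hT, hk, htb, hbt, hu, hv, huv, hX, hZ, hY⟩ :=
    h.exists_T_pattern hinj
  have hg : ∀ x x', ‖f x' 0 - f x 0‖ ^ 2 ≤ (x' - x) ^ 2 := fun x x' => by
    simpa using h.norm_sub_sq_le (x := x) (x' := x') (y := 0) (y' := 0) (by simp) (by simp)
  have hX' : f (t + 2 * lam) 0 = m - (T / 2) • u := by
    rw [← hX]; exact h.periodic (y := 0) (by simp) t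
  have d₁ : ‖f b 0 - f t 0‖ ^ 2 = (p + T / 2) ^ 2 + k ^ 2 := by
    rw [← norm_combo_sq hu hv huv, hX, hY]
    congr 2; module
  have d₂ : ‖f (t + lam + τ) 0 - f b 0‖ ^ 2 = (p - T / 2) ^ 2 + k ^ 2 := by
    rw [← neg_sq k, ← neg_sq (p - T / 2), ← norm_combo_sq hu hv huv, hZ, hY]
    congr 2; module
  have d₃ : ‖f (t + 2 * lam) 0 - f (t + lam + τ) 0‖ ^ 2 = T ^ 2 := by
    rw [hX', hZ, show m - (T / 2) • u - (m + (T / 2) • u) = (-T) • u by module, norm_smul, hu]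
    simp
  have i₁ := hg t b
  have i₂ := hg b (t + lam + τ)
  have i₃ := hg (t + lam + τ) (t + 2 * lam)
  rw [d₁] at i₁
  rw [d₂] at i₂
  rw [d₃, show t + 2 * lam - (t + lam + τ) = lam - τ by ring] at i₃
  obtain ⟨hD, e₁, e₂, hp⟩ := triangle_defect_bounds hk (sub_nonneg.2 htb) (sub_nonneg.2 hbt) i₁ i₂
  rw [show b - t + (t + lam + τ - b) = lam + τ by ring] at hD e₁ e₂ hp
  obtain ⟨hD8, e₃, hτ, hTc, hT2, hk'⟩ := T_pattern_size_bounds hε0 hε h.pos hratio hT0 hT hk hD i₃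
  replace hp : p ^ 2 ≤ 8 * ε * (1 / 2 + 11 / 6 / 8) := by
    refine hp.trans (mul_le_mul hD8 (by linarith) (by positivity) (by linarith))
  have hρ : 0 < Real.sqrt ε := Real.sqrt_pos.2 hε0
  have hρ2 : Real.sqrt ε ^ 2 = ε := Real.sq_sqrt hε0.le
  have hρ1 : Real.sqrt ε < 1 / 2 := by
    rw [Real.sqrt_lt' (by norm_num)]
    linarith
  have hερ : ε ≤ Real.sqrt ε / 2 := by
    have := mul_le_mul_of_nonneg_left hρ1.le hρ.le
    linarith
  have hs3 : Real.sqrt 3 ^ 2 = 3 := Real.sq_sqrt (by norm_num)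
  have hc0 : 0 ≤ 2 * Real.sqrt 3 / 3 := by positivity
  set c := 2 * Real.sqrt 3 / 3 with hc
  have hc2 : c ^ 2 = 4 / 3 := by rw [hc]; linear_combination (4 / 9) * hs3
  have hcu : ∀ z : ℝ, ‖z • u‖ = |z| := fun z => by rw [norm_smul, hu, mul_one, Real.norm_eq_abs]
  have hA : ‖m - (c / 2) • u - (m - (T / 2) • u)‖ ≤ 3 * Real.sqrt ε := by
    rw [show m - (c / 2) • u - (m - (T / 2) • u) = ((T - c) / 2) • u by module, hcu, abs_div,
      abs_two]
    linarith
  have hC : ‖m + (c / 2) • u - (m + (T / 2) • u)‖ ≤ 3 * Real.sqrt ε := by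
    rw [show m + (c / 2) • u - (m + (T / 2) • u) = (-((T - c) / 2)) • u by module, hcu, abs_neg,
      abs_div, abs_two]
    linarith
  have hB : ‖m + v - (m + p • u + k • v)‖ ≤ 3 * Real.sqrt ε := by
    rw [show m + v - (m + p • u + k • v) = (-p) • u + (1 - k) • v by module]
    refine (abs_le_of_sq_le_sq' ?_ (by positivity)).2
    rw [norm_combo_sq hu hv huv, mul_pow, hρ2]
    have := mul_le_mul hk' (hk'.trans hε.le) (by linarith) hε0.le
    linarith
  have tri : ∀ {P Q : E3} {x y : ℝ}, Q - P = x • u + y • v → x ^ 2 + y ^ 2 = 4 / 3 → dist P Q = c := by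
    intro P Q x y hPQ hxy
    rw [dist_comm, dist_eq_norm, hPQ, ← sq_eq_sq₀ (norm_nonneg _) hc0, norm_combo_sq hu hv huv, hxy,
      hc2]
  refine ⟨m - (c / 2) • u, m + v, m + (c / 2) • u, t, b, t + lam + τ,
    tri (x := c / 2) (y := 1) (by module) (by linarith),
    tri (x := c / 2) (y := -1) (by module) (by linarith),
    tri (x := -c) (y := 0) (by module) (by linarith), ?_, ?_, by linarith, fun r hr => ⟨?_, ?_, ?_⟩⟩
  · refine lt_of_le_of_ne htb fun he => ?_
    rw [he] at i₁
    linarith [sq_nonneg (p + T / 2), sq_nonneg (k - 1)]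
  · refine lt_of_le_of_ne hbt fun he => ?_
    rw [← he] at i₂
    linarith [sq_nonneg (p - T / 2), sq_nonneg (k - 1)]
  · exact norm_segment_sub_arc_lt hε0 (g := fun s => f s 0) hg (by simp only [d₁]; exact e₁.trans hD8)
      (by simp only [hX]; exact hA) (by simp only [hY]; exact hB) hr
  · exact norm_segment_sub_arc_lt hε0 (g := fun s => f s 0) hg (by simp only [d₂]; exact e₂.trans hD8)
      (by simp only [hY]; exact hB) (by simp only [hZ]; exact hC) hr
  · exact norm_segment_sub_arc_lt hε0 (g := fun s => f s 0) hg
      (by simp only [d₃]; rw [show t + 2 * lam - (t + lam + τ) = lam - τ by ring]; exact e₃)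
      (by simp only [hZ]; exact hC) (by simp only [hX']; exact hA) hr

/-- The extension `s ↦ g (fract s) + ⌊s⌋ • d` of a curve on the unit interval with `g 1 = g 0 + d`. -/
noncomputable def floorExtend {W : Type*} [AddCommGroup W] [Module ℝ W] (g : ℝ → W) (d : W) (s : ℝ) : W :=
  g (Int.fract s) + (⌊s⌋ : ℝ) • d

section FloorExtend

variable {W : Type*} [NormedAddCommGroup W] [NormedSpace ℝ W] {g : ℝ → W} {d : W}

theorem floorExtend_add_one (s : ℝ) : floorExtend g d (s + 1) = floorExtend g d s + d := by
  simp only [floorExtend, Int.fract_add_one, Int.floor_add_one]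
  push_cast
  module

theorem floorExtend_of_mem (hgd : g 1 = g 0 + d) {s : ℝ} (hs : s ∈ Set.Icc (0 : ℝ) 1) :
    floorExtend g d s = g s := by
  rcases hs.2.lt_or_eq with h | rfl
  · rw [floorExtend, Int.fract_eq_self.2 ⟨hs.1, h⟩, Int.floor_eq_zero_iff.2 ⟨hs.1, h⟩]
    simp
  · simp [floorExtend, hgd]

theorem continuous_floorExtend (hg : ContinuousOn g (Set.Icc 0 1)) (hgd : g 1 = g 0 + d) :
    Continuous (floorExtend g d) := by
  have hd : floorExtend g d = fun s => (g (Int.fract s) - Int.fract s • d) + s • d := by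
    ext s
    rw [floorExtend, Int.fract]
    module
  have h := ContinuousOn.comp_fract'' (f := fun r => g r - r • d) (hg.sub (by fun_prop))
    (by simp [hgd])
  rw [hd]
  exact h.add (by fun_prop)

end FloorExtend

theorem strictMono_floorExtend {g : ℝ → ℝ} {d : ℝ} (hg : StrictMonoOn g (Set.Icc 0 1))
    (hgd : g 1 = g 0 + d) : StrictMono (floorExtend g d) := by
  intro s s' hs
  have hd : 0 < d := by
    have := hg (by simp) (by simp) zero_lt_one
    linarith
  have mem : ∀ x : ℝ, Int.fract x ∈ Set.Icc (0 : ℝ) 1 := fun x =>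
    ⟨Int.fract_nonneg x, (Int.fract_lt_one x).le⟩
  simp only [floorExtend, smul_eq_mul]
  rcases (Int.floor_mono hs.le).lt_or_eq with h | h
  · have h1 : g (Int.fract s) < g 1 := hg (mem s) (by simp) (Int.fract_lt_one s)
    have h2 : g 0 ≤ g (Int.fract s') := hg.monotoneOn (by simp) (mem s') (Int.fract_nonneg s')
    have h3 : (⌊s⌋ : ℝ) + 1 ≤ ⌊s'⌋ := by exact_mod_cast h
    nlinarith
  · have : Int.fract s < Int.fract s' := by
      rw [Int.fract, Int.fract, h]
      linarith
    rw [h]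
    linarith [hg (mem s) (mem s') this]

/-- The piecewise affine curve on `[0, 1]` through `a`, `b`, `c`, `d` at times `0`, `1 / 3`, `2 / 3`, `1`. -/
noncomputable def threeLeg {W : Type*} [AddCommGroup W] [Module ℝ W] (a b c d : W) (s : ℝ) : W :=
  if s ≤ 1 / 3 then a + (3 * s) • (b - a)
  else if s ≤ 2 / 3 then b + (3 * s - 1) • (c - b)
  else c + (3 * s - 2) • (d - c)

section ThreeLeg

variable {W : Type*} [NormedAddCommGroup W] [NormedSpace ℝ W] {a b c d : W} {s : ℝ}

theorem threeLeg_of_le (h : s ≤ 1 / 3) : threeLeg a b c d s = a + (3 * s) • (b - a) := if_pos h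

theorem threeLeg_of_mem (h : s ∈ Set.Icc (1 / 3 : ℝ) (2 / 3)) :
    threeLeg a b c d s = b + (3 * s - 1) • (c - b) := by
  rcases h.1.lt_or_eq with h' | rfl
  · rw [threeLeg, if_neg h'.not_ge, if_pos h.2]
  · rw [threeLeg, if_pos le_rfl]
    norm_num

theorem threeLeg_of_ge (h : 2 / 3 ≤ s) : threeLeg a b c d s = c + (3 * s - 2) • (d - c) := by
  rcases h.lt_or_eq with h' | rfl
  · rw [threeLeg, if_neg (by linarith), if_neg h'.not_ge]
  · rw [threeLeg_of_mem (by norm_num)]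
    norm_num

theorem threeLeg_zero : threeLeg a b c d 0 = a := by
  rw [threeLeg_of_le (by norm_num)]; simp

theorem threeLeg_one : threeLeg a b c d 1 = d := by
  rw [threeLeg_of_ge (by norm_num)]; norm_num

theorem continuous_threeLeg : Continuous (threeLeg a b c d) := by
  refine Continuous.if_le (by fun_prop) (Continuous.if_le (by fun_prop) (by fun_prop) (by fun_prop)
    (by fun_prop) ?_) (by fun_prop) (by fun_prop) ?_
  · rintro x rfl
    norm_num
  · rintro x rfl
    norm_num

end ThreeLeg

theorem strictMono_threeLeg {a b c d : ℝ} (hab : a < b) (hbc : b < c) (hcd : c < d) :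
    StrictMono (threeLeg a b c d) := by
  have aff : ∀ x y z w : ℝ, x < y → StrictMono fun s : ℝ => z + (3 * s - w) • (y - x) := by
    intro x y z w hxy s s' hs
    simp only [smul_eq_mul]
    have := mul_lt_mul_of_pos_right hs (sub_pos.2 hxy)
    linarith
  have h₁ : StrictMonoOn (threeLeg a b c d) (Set.Iic (1 / 3)) :=
    ((aff a b a 0 hab).strictMonoOn _).congr fun s hs => by
      simp only [threeLeg_of_le hs, sub_zero]
  have h₂ : StrictMonoOn (threeLeg a b c d) (Set.Icc (1 / 3) (2 / 3)) :=
    ((aff b c b 1 hbc).strictMonoOn _).congr fun s hs => by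
      rw [threeLeg_of_mem hs]
  have h₃ : StrictMonoOn (threeLeg a b c d) (Set.Ici (2 / 3)) :=
    ((aff c d c 2 hcd).strictMonoOn _).congr fun s hs => by
      rw [threeLeg_of_ge hs]
  have h₁₂ := h₁.union h₂ (c := 1 / 3) ⟨Set.self_mem_Iic, fun _ hx => hx⟩
    ⟨⟨le_rfl, by norm_num⟩, fun _ hx => hx.1⟩
  rw [Set.Iic_union_Icc_eq_Iic (by norm_num)] at h₁₂
  exact h₁₂.Iic_union_Ici h₃

theorem image_threeLeg {W : Type*} [NormedAddCommGroup W] [NormedSpace ℝ W] (a b c d : W) :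
    threeLeg a b c d '' Set.Icc 0 1 = segment ℝ a b ∪ segment ℝ b c ∪ segment ℝ c d := by
  simp only [segment_eq_image']
  ext x
  simp only [Set.mem_union, Set.mem_image]
  constructor
  · rintro ⟨s, hs, rfl⟩
    rcases le_total s (1 / 3) with h1 | h1
    · exact .inl (.inl ⟨3 * s, ⟨by linarith [hs.1], by linarith⟩, (threeLeg_of_le h1).symm⟩)
    rcases le_total s (2 / 3) with h2 | h2
    · exact .inl (.inr ⟨3 * s - 1, ⟨by linarith, by linarith⟩, (threeLeg_of_mem ⟨h1, h2⟩).symm⟩)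
    · exact .inr ⟨3 * s - 2, ⟨by linarith, by linarith [hs.2]⟩, (threeLeg_of_ge h2).symm⟩
  · rintro ((⟨r, hr, rfl⟩ | ⟨r, hr, rfl⟩) | ⟨r, hr, rfl⟩) <;> obtain ⟨hr0, hr1⟩ := hr
    · refine ⟨r / 3, ⟨by linarith, by linarith⟩, ?_⟩
      rw [threeLeg_of_le (by linarith), mul_div_cancel₀ _ three_ne_zero]
    · refine ⟨(r + 1) / 3, ⟨by linarith, by linarith⟩, ?_⟩
      rw [threeLeg_of_mem ⟨by linarith, by linarith⟩]
      congr 2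
      ring
    · refine ⟨(r + 2) / 3, ⟨by linarith, by linarith⟩, ?_⟩
      rw [threeLeg_of_ge (by linarith)]
      congr 2
      ring

/-- A quasi-periodic reparametrization and the closed polygon it follows, of period `3 * c`, built from
three arcs of the band boundary. -/
theorem exists_triangle_loop {W : Type*} [NormedAddCommGroup W] [NormedSpace ℝ W] {A B C : W}
    {t₀ t₁ t₂ P δ c : ℝ} (hc : 0 < c) {g : ℝ → W} (hg : Function.Periodic g P) (h₀₁ : t₀ < t₁)
    (h₁₂ : t₁ < t₂) (h₂ : t₂ < t₀ + P)
    (hclose : ∀ r ∈ Set.Icc (0 : ℝ) 1,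
      ‖A + r • (B - A) - g (t₀ + r * (t₁ - t₀))‖ < δ ∧
      ‖B + r • (C - B) - g (t₁ + r * (t₂ - t₁))‖ < δ ∧
      ‖C + r • (A - C) - g (t₂ + r * (t₀ + P - t₂))‖ < δ) :
    ∃ (γ : ℝ → W) (φ : ℝ → ℝ), Continuous γ ∧ (∀ s, γ (s + 3 * c) = γ s) ∧
      (∀ s ∈ Set.Icc 0 c, γ s = A + (s / c) • (B - A)) ∧
      (∀ s ∈ Set.Icc c (2 * c), γ s = B + ((s - c) / c) • (C - B)) ∧
      (∀ s ∈ Set.Icc (2 * c) (3 * c), γ s = C + ((s - 2 * c) / c) • (A - C)) ∧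
      γ '' Set.Icc 0 (3 * c) = segment ℝ A B ∪ segment ℝ B C ∪ segment ℝ C A ∧
      Continuous φ ∧ StrictMono φ ∧ (∀ s, φ (s + 3 * c) = φ s + P) ∧
      ∀ s, ‖γ s - g (φ s)‖ < δ := by
  have hL : 0 < 3 * c := by positivity
  have hγe : threeLeg A B C A 1 = threeLeg A B C A 0 + 0 := by
    rw [threeLeg_one, threeLeg_zero, add_zero]
  have hφe : threeLeg t₀ t₁ t₂ (t₀ + P) 1 = threeLeg t₀ t₁ t₂ (t₀ + P) 0 + P := by
    rw [threeLeg_one, threeLeg_zero]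
  have hφm := strictMono_floorExtend ((strictMono_threeLeg h₀₁ h₁₂ h₂).strictMonoOn _) hφe
  have hshift : ∀ s : ℝ, (s + 3 * c) / (3 * c) = s / (3 * c) + 1 := fun s => by
    rw [add_div, div_self hL.ne']
  have hunit : ∀ s ∈ Set.Icc 0 (3 * c), s / (3 * c) ∈ Set.Icc (0 : ℝ) 1 := fun s hs =>
    ⟨div_nonneg hs.1 hL.le, (div_le_one hL).2 hs.2⟩
  have hγ : ∀ s ∈ Set.Icc 0 (3 * c),
      floorExtend (threeLeg A B C A) 0 (s / (3 * c)) = threeLeg A B C A (s / (3 * c)) :=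
    fun s hs => floorExtend_of_mem hγe (hunit s hs)
  have hscale : ∀ s : ℝ, 3 * (s / (3 * c)) = s / c := fun s => by field_simp
  refine ⟨fun s => floorExtend (threeLeg A B C A) 0 (s / (3 * c)),
    fun s => floorExtend (threeLeg t₀ t₁ t₂ (t₀ + P)) P (s / (3 * c)),
    (continuous_floorExtend continuous_threeLeg.continuousOn hγe).comp (by fun_prop),
    fun s => ?_, fun s hs => ?_, fun s hs => ?_, fun s hs => ?_, ?_,
    (continuous_floorExtend continuous_threeLeg.continuousOn hφe).comp (by fun_prop),
    fun s s' hs => hφm (div_lt_div_of_pos_right hs hL), fun s => ?_, fun s => ?_⟩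
  · simp only [hshift, floorExtend_add_one, add_zero]
  · simp only [hγ s ⟨hs.1, hs.2.trans (by linarith)⟩]
    rw [threeLeg_of_le, hscale]
    rw [div_le_iff₀ hL]
    linarith [hs.2]
  · simp only [hγ s ⟨hc.le.trans hs.1, hs.2.trans (by linarith)⟩]
    rw [threeLeg_of_mem, hscale, sub_div, div_self hc.ne']
    constructor
    · rw [le_div_iff₀ hL]
      linarith [hs.1]
    · rw [div_le_iff₀ hL]
      linarith [hs.2]
  · simp only [hγ s ⟨le_trans (by positivity) hs.1, hs.2⟩]
    rw [threeLeg_of_ge, hscale, sub_div, mul_div_cancel_right₀ _ hc.ne']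
    rw [le_div_iff₀ hL]
    linarith [hs.1]
  · rw [← image_threeLeg]
    ext x
    constructor
    · rintro ⟨s, hs, rfl⟩
      exact ⟨s / (3 * c), hunit s hs, (hγ s hs).symm⟩
    · rintro ⟨s, hs, rfl⟩
      have hs' : s * (3 * c) ∈ Set.Icc 0 (3 * c) :=
        ⟨mul_nonneg hs.1 hL.le, mul_le_of_le_one_left hL.le hs.2⟩
      refine ⟨s * (3 * c), hs', ?_⟩
      simp only [mul_div_cancel_right₀ _ hL.ne', floorExtend_of_mem hγe hs]
  · simp only [hshift, floorExtend_add_one]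
  · simp only [floorExtend, smul_zero, add_zero, smul_eq_mul]
    rw [hg.int_mul ⌊s / (3 * c)⌋]
    have h0 := Int.fract_nonneg (s / (3 * c))
    have h1 := (Int.fract_lt_one (s / (3 * c))).le
    generalize Int.fract (s / (3 * c)) = x at h0 h1
    rcases le_total x (1 / 3) with h | h
    · rw [threeLeg_of_le h, threeLeg_of_le h]
      exact (hclose (3 * x) ⟨by linarith, by linarith⟩).1
    rcases le_total x (2 / 3) with h' | h'
    · rw [threeLeg_of_mem ⟨h, h'⟩, threeLeg_of_mem ⟨h, h'⟩]
      exact (hclose (3 * x - 1) ⟨by linarith, by linarith⟩).2.1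
    · rw [threeLeg_of_ge h', threeLeg_of_ge h']
      exact (hclose (3 * x - 2) ⟨by linarith, by linarith⟩).2.2

end PaperMoebius

/-- **Effective boundary theorem.** If `0 < ε < 1/4` and `f` encodes a smooth embedded
paper Moebius band of aspect ratio `lam < √3 + ε`, then there are vertices `A, B, C`
with pairwise distances `2√3/3`, a continuous `2√3`-periodic unit-speed curve `γ₀`
traversing the boundary of the triangle `ABC` once (affine with speed 1 on each of the
three edge parameter intervals), a continuous strictly increasing `φ : ℝ → ℝ` with
`φ(s + 2√3) = φ(s) + 2·lam`, and an isometry `ψ` of `ℝ³`, such that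
`‖γ₀(s) − ψ(f (φ s) 0)‖ < 6√ε` for all `s`. -/
theorem boundary_close_to_triangle
    (ε lam : ℝ) (hε0 : 0 < ε) (hε : ε < 1 / 4)
    (hlam : 0 < lam)
    (f : ℝ → ℝ → EuclideanSpace ℝ (Fin 3))
    (hsmooth : ContDiff ℝ (⊤ : ℕ∞) (fun p : ℝ × ℝ => f p.1 p.2))
    (hglue : ∀ x : ℝ, ∀ y ∈ Set.Icc (0 : ℝ) 1, f (x + lam) (1 - y) = f x y)
    (hisom : ∀ p : ℝ × ℝ, p.2 ∈ Set.Icc (0 : ℝ) 1 → ∀ v : ℝ × ℝ,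
      ‖fderiv ℝ (fun q : ℝ × ℝ => f q.1 q.2) p v‖ = Real.sqrt (v.1 ^ 2 + v.2 ^ 2))
    (hinj : ∀ x x' y y' : ℝ, x ∈ Set.Ico (0 : ℝ) lam → x' ∈ Set.Ico (0 : ℝ) lam →
      y ∈ Set.Icc (0 : ℝ) 1 → y' ∈ Set.Icc (0 : ℝ) 1 →
      f x y = f x' y' → x = x' ∧ y = y')
    (hratio : lam < Real.sqrt 3 + ε) :
    ∃ A B C : EuclideanSpace ℝ (Fin 3),
    ∃ γ₀ : ℝ → EuclideanSpace ℝ (Fin 3),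
    ∃ φ : ℝ → ℝ,
    ∃ ψ : EuclideanSpace ℝ (Fin 3) ≃ᵢ EuclideanSpace ℝ (Fin 3),
      dist A B = 2 * Real.sqrt 3 / 3 ∧ dist B C = 2 * Real.sqrt 3 / 3 ∧
      dist C A = 2 * Real.sqrt 3 / 3 ∧
      Continuous γ₀ ∧
      (∀ s : ℝ, γ₀ (s + 2 * Real.sqrt 3) = γ₀ s) ∧
      (∀ s ∈ Set.Icc (0 : ℝ) (2 * Real.sqrt 3 / 3),
        γ₀ s = A + (s / (2 * Real.sqrt 3 / 3)) • (B - A)) ∧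
      (∀ s ∈ Set.Icc (2 * Real.sqrt 3 / 3) (4 * Real.sqrt 3 / 3),
        γ₀ s = B + ((s - 2 * Real.sqrt 3 / 3) / (2 * Real.sqrt 3 / 3)) • (C - B)) ∧
      (∀ s ∈ Set.Icc (4 * Real.sqrt 3 / 3) (2 * Real.sqrt 3),
        γ₀ s = C + ((s - 4 * Real.sqrt 3 / 3) / (2 * Real.sqrt 3 / 3)) • (A - C)) ∧
      γ₀ '' Set.Icc (0 : ℝ) (2 * Real.sqrt 3) =
        segment ℝ A B ∪ segment ℝ B C ∪ segment ℝ C A ∧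
      Continuous φ ∧ StrictMono φ ∧
      (∀ s : ℝ, φ (s + 2 * Real.sqrt 3) = φ s + 2 * lam) ∧
      (∀ s : ℝ, ‖γ₀ s - ψ (f (φ s) 0)‖ < 6 * Real.sqrt ε) := by
  have hband : PaperMoebius.IsPaperBand lam f := ⟨hlam, hsmooth, hglue, hisom⟩
  obtain ⟨A, B, C, t₀, t₁, t₂, hAB, hBC, hCA, h₀₁, h₁₂, h₂, hclose⟩ :=
    hband.exists_triangle hinj hε0 hε hratio
  have hc : 0 < 2 * Real.sqrt 3 / 3 := by positivity
  obtain ⟨γ, φ, hγ, hγp, hγ₁, hγ₂, hγ₃, himage, hφ, hφm, hφp, hdist⟩ :=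
    PaperMoebius.exists_triangle_loop (g := fun s => f s 0) hc (hband.periodic (by simp)) h₀₁ h₁₂ h₂
      hclose
  rw [show 2 * (2 * Real.sqrt 3 / 3) = 4 * Real.sqrt 3 / 3 by ring] at hγ₂ hγ₃
  rw [show 3 * (2 * Real.sqrt 3 / 3) = 2 * Real.sqrt 3 by ring] at hγp hγ₃ himage hφp
  exact ⟨A, B, C, γ, φ, IsometryEquiv.refl _, hAB, hBC, hCA, hγ, hγp, hγ₁, hγ₂, hγ₃, himage, hφ, hφm,
    hφp, hdist⟩
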